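/- Let κ be a perfect kernel on X satisfying Frostman's maximum principle and the domination principle, let A ⊆ X satisfy cap_*(A) > 0 and E⁺(A) closed in (E⁺, d), let f := −U^ζ where ζ ∈ E⁺ and ζ(X) ≤ 1, and assume either cap_*(A) < ∞ or ζ^A(X) = 1, so that the solution λ_{A,f} exists. Then the inner f-weighted equilibrium constant c_{A,f} := ∫ U_f^{λ_{A,f}} dλ_{A,f} equals η_{A,f} := (1 − ζ^A(X))/cap_*(A); moreover, the net of constants c_{K,f} := ∫ U_f^{λ_{K,f}} dλ_{K,f}, indexed by compact K ⊆ A large enough that λ_{K,f} exists, is decreasing and c_{K,f} ↓ c_{A,f} as K ↑ A. -/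

import Mathlib

open MeasureTheory Topology Filter Set ENNReal

noncomputable section

namespace GaussVar

variable {X : Type*} [TopologicalSpace X] [MeasurableSpace X]

/-- A (positive) Radon measure: a regular Borel measure. -/
def IsRadon (μ : Measure X) : Prop := μ.Regular

/-- The mutual energy `I(μ,ν) = ∬ κ(x,y) d(μ⊗ν)(x,y)`. -/
def mutualEnergy (κ : X → X → ℝ≥0∞) (μ ν : Measure X) : ℝ≥0∞ :=
  ∫⁻ p : X × X, κ p.1 p.2 ∂(μ.prod ν)

/-- The energy `I(μ) := I(μ,μ)`. -/
def energy (κ : X → X → ℝ≥0∞) (μ : Measure X) : ℝ≥0∞ := mutualEnergy κ μ μ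

/-- Membership in the cone `E⁺` of Radon measures with finite energy. -/
def memEplus (κ : X → X → ℝ≥0∞) (μ : Measure X) : Prop :=
  IsRadon μ ∧ energy κ μ < ⊤

/-- A kernel: symmetric and lower semicontinuous with values in `[0,∞]`. -/
def IsKernel (κ : X → X → ℝ≥0∞) : Prop :=
  (∀ x y, κ x y = κ y x) ∧ LowerSemicontinuous (fun p : X × X => κ p.1 p.2)

/-- The strong (energy) metric `d(μ,ν) := (I(μ)+I(ν)−2I(μ,ν))^{1/2}` on `E⁺`. -/
def strongDist (κ : X → X → ℝ≥0∞) (μ ν : Measure X) : ℝ :=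
  Real.sqrt ((energy κ μ).toReal + (energy κ ν).toReal - 2 * (mutualEnergy κ μ ν).toReal)

/-- The energy principle (strict positive definiteness). -/
def EnergyPrinciple (κ : X → X → ℝ≥0∞) : Prop :=
  ∀ μ ν : Measure X, memEplus κ μ → memEplus κ ν →
    2 * mutualEnergy κ μ ν ≤ energy κ μ + energy κ ν ∧
      (2 * mutualEnergy κ μ ν = energy κ μ + energy κ ν → μ = ν)

/-- Convergence of a sequence in the strong metric. -/
def StrongTendstoSeq (κ : X → X → ℝ≥0∞) (μ : ℕ → Measure X) (μ₀ : Measure X) : Prop :=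
  Tendsto (fun n => strongDist κ (μ n) μ₀) atTop (𝓝 0)

/-- Vague convergence of a sequence of measures. -/
def VagueTendstoSeq (μ : ℕ → Measure X) (μ₀ : Measure X) : Prop :=
  ∀ φ : X → ℝ, Continuous φ → HasCompactSupport φ →
    Tendsto (fun n => ∫ x, φ x ∂(μ n)) atTop (𝓝 (∫ x, φ x ∂μ₀))

/-- Cauchy sequence in the strong metric. -/
def StrongCauchySeq (κ : X → X → ℝ≥0∞) (μ : ℕ → Measure X) : Prop :=
  ∀ ε : ℝ, 0 < ε → ∃ N : ℕ, ∀ m ≥ N, ∀ n ≥ N, strongDist κ (μ m) (μ n) < ε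

/-- A perfect kernel: satisfies the energy principle, `(E⁺,d)` is complete, and
strong convergence implies vague convergence. -/
def IsPerfect (κ : X → X → ℝ≥0∞) : Prop :=
  EnergyPrinciple κ ∧
    (∀ μ : ℕ → Measure X, (∀ n, memEplus κ (μ n)) → StrongCauchySeq κ μ →
        ∃ μ₀ : Measure X, memEplus κ μ₀ ∧ StrongTendstoSeq κ μ μ₀) ∧
    (∀ (μ : ℕ → Measure X) (μ₀ : Measure X), (∀ n, memEplus κ (μ n)) → memEplus κ μ₀ →
        StrongTendstoSeq κ μ μ₀ → VagueTendstoSeq μ μ₀)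

/-- `μ` is concentrated on `A`: the complement of `A` is locally `μ`-negligible. -/
def Concentrated (μ : Measure X) (A : Set X) : Prop :=
  ∀ K : Set X, IsCompact K → μ (Aᶜ ∩ K) = 0

/-- Membership in `Ĕ⁺(A)`: finite-energy Radon measures concentrated on `A`
of unit total mass. -/
def memBreve (κ : X → X → ℝ≥0∞) (A : Set X) (μ : Measure X) : Prop :=
  memEplus κ μ ∧ Concentrated μ A ∧ μ Set.univ = 1

/-- `w(A) := inf { I(μ) : μ ∈ Ĕ⁺(A) }` (with `inf ∅ = ⊤`). -/
def wcap (κ : X → X → ℝ≥0∞) (A : Set X) : ℝ≥0∞ :=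
  ⨅ (μ : Measure X) (_ : memBreve κ A μ), energy κ μ

/-- The inner capacity `cap_*(A) := 1 / w(A)`. -/
def innerCap (κ : X → X → ℝ≥0∞) (A : Set X) : ℝ≥0∞ := (wcap κ A)⁻¹

/-- The outer capacity `cap^*(E) := inf { cap_*(D) : D open, E ⊆ D }`. -/
def outerCap (κ : X → X → ℝ≥0∞) (E : Set X) : ℝ≥0∞ :=
  ⨅ (D : Set X) (_ : IsOpen D ∧ E ⊆ D), innerCap κ D

/-- `P` holds nearly everywhere (n.e.) on `A`: the exceptional subset of `A`
has inner capacity zero. -/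
def NearlyEverywhere (κ : X → X → ℝ≥0∞) (A : Set X) (P : X → Prop) : Prop :=
  innerCap κ {x ∈ A | ¬ P x} = 0

/-- The potential `U^μ(x) := ∫ κ(x,y) dμ(y)`. -/
def potential (κ : X → X → ℝ≥0∞) (μ : Measure X) (x : X) : ℝ≥0∞ :=
  ∫⁻ y, κ x y ∂μ

/-- An external field: `f = ψ + U^{ϑ⁺} − U^{ϑ⁻}` where `ψ` is lower semicontinuous,
`(−∞,∞]`-valued, positive if `X` is noncompact, and `ϑ⁺, ϑ⁻ ∈ E⁺`. -/
def IsExternalField (κ : X → X → ℝ≥0∞) (f : X → EReal) : Prop :=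
  ∃ (ψ : X → EReal) (ϑp ϑm : Measure X),
    LowerSemicontinuous ψ ∧ (∀ x, ψ x ≠ ⊥) ∧ (¬ CompactSpace X → ∀ x, 0 ≤ ψ x) ∧
    memEplus κ ϑp ∧ memEplus κ ϑm ∧
    ∀ x, f x = ψ x + (potential κ ϑp x : EReal) - (potential κ ϑm x : EReal)

/-- `f` is `μ`-integrable (as an extended-real-valued function). -/
def FieldIntegrable (f : X → EReal) (μ : Measure X) : Prop :=
  Integrable (fun x => (f x).toReal) μ ∧ (∀ᵐ x ∂μ, f x ≠ ⊤ ∧ f x ≠ ⊥)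

/-- `∫ f dμ` for an a.e.-finite integrable field. -/
def fieldIntegral (f : X → EReal) (μ : Measure X) : ℝ := ∫ x, (f x).toReal ∂μ

/-- The Gauss functional `I_f(μ) := I(μ) + 2 ∫ f dμ`. -/
def gaussI (κ : X → X → ℝ≥0∞) (f : X → EReal) (μ : Measure X) : ℝ :=
  (energy κ μ).toReal + 2 * fieldIntegral f μ

/-- Membership in `Ĕ⁺_f(A)`. -/
def Admissible (κ : X → X → ℝ≥0∞) (A : Set X) (f : X → EReal) (μ : Measure X) : Prop :=
  memBreve κ A μ ∧ FieldIntegrable f μ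

/-- `w_f(A) := inf { I_f(μ) : μ ∈ Ĕ⁺_f(A) }` (with `inf ∅ = ⊤`). -/
def wf (κ : X → X → ℝ≥0∞) (A : Set X) (f : X → EReal) : EReal :=
  ⨅ (μ : Measure X) (_ : Admissible κ A f μ), ((gaussI κ f μ : ℝ) : EReal)

/-- `l` is a solution of the inner Gauss variational problem for `(A,f)`. -/
def IsSolution (κ : X → X → ℝ≥0∞) (A : Set X) (f : X → EReal) (l : Measure X) : Prop :=
  Admissible κ A f l ∧ ((gaussI κ f l : ℝ) : EReal) = wf κ A f

/-- The `f`-weighted potential `U_f^μ := U^μ + f`. -/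
def wPotential (κ : X → X → ℝ≥0∞) (f : X → EReal) (μ : Measure X) (x : X) : EReal :=
  (potential κ μ x : EReal) + f x

/-- `∫ U_f^μ dμ`, the weighted equilibrium constant of a solution. -/
def wConst (κ : X → X → ℝ≥0∞) (f : X → EReal) (μ : Measure X) : ℝ :=
  ∫ x, (wPotential κ f μ x).toReal ∂μ

/-- The cone `E⁺(A)` is closed in the strong metric. -/
def StrongClosedEplusOn (κ : X → X → ℝ≥0∞) (A : Set X) : Prop :=
  ∀ (μ : ℕ → Measure X) (μ₀ : Measure X),
    (∀ n, memEplus κ (μ n) ∧ Concentrated (μ n) A) →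
    memEplus κ μ₀ → StrongTendstoSeq κ μ μ₀ → Concentrated μ₀ A

/-- Frostman's (first) maximum principle. -/
def FrostmanMax (κ : X → X → ℝ≥0∞) : Prop :=
  ∀ μ : Measure X, memEplus κ μ →
    (∀ x : X, (∀ U : Set X, IsOpen U → x ∈ U → 0 < μ U) → potential κ μ x ≤ 1) →
    ∀ x : X, potential κ μ x ≤ 1

/-- The domination (second maximum) principle. -/
def DominationPrinciple (κ : X → X → ℝ≥0∞) : Prop :=
  ∀ μ ν : Measure X, memEplus κ μ → memEplus κ ν →
    (∀ᵐ x ∂μ, potential κ μ x ≤ potential κ ν x) →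
    ∀ x : X, potential κ μ x ≤ potential κ ν x

/-- `β` is the inner balayage of `ζ` onto `A`: `β ∈ E⁺(A)` and `U^β = U^ζ` n.e. on `A`. -/
def IsInnerBalayage (κ : X → X → ℝ≥0∞) (A : Set X) (ζ β : Measure X) : Prop :=
  memEplus κ β ∧ Concentrated β A ∧
    NearlyEverywhere κ A (fun x => potential κ β x = potential κ ζ x)

/-- `γ` is the inner capacitary measure of `A`: `γ ∈ E⁺(A)` and `U^γ = 1` n.e. on `A`. -/
def IsCapacitaryMeasure (κ : X → X → ℝ≥0∞) (A : Set X) (γ : Measure X) : Prop :=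
  memEplus κ γ ∧ Concentrated γ A ∧
    NearlyEverywhere κ A (fun x => potential κ γ x = 1)

/-- `A` is quasiclosed: approximable in outer capacity by closed sets. -/
def Quasiclosed (κ : X → X → ℝ≥0∞) (A : Set X) : Prop :=
  ∀ ε : ℝ≥0∞, 0 < ε → ∃ F : Set X, IsClosed F ∧ outerCap κ (symmDiff A F) < ε

/-- `A` is quasicompact: approximable in outer capacity by compact sets. -/
def Quasicompact (κ : X → X → ℝ≥0∞) (A : Set X) : Prop :=
  ∀ ε : ℝ≥0∞, 0 < ε → ∃ K : Set X, IsCompact K ∧ outerCap κ (symmDiff A K) < ε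

theorem IsKernel.lowerSemicontinuous_right {X : Type*} [TopologicalSpace X]
    {κ : X → X → ℝ≥0∞} (hκ : IsKernel κ) (x : X) : LowerSemicontinuous (κ x) :=
  hκ.2.comp (Continuous.prodMk_right x)

section Sections

open scoped NNReal

theorem mutualEnergy_comm {κ : X → X → ℝ≥0∞} (hκ : IsKernel κ) (μ ν : Measure X) [IsFiniteMeasure μ]
    [IsFiniteMeasure ν] : mutualEnergy κ μ ν = mutualEnergy κ ν μ := by
  unfold mutualEnergy
  rw [← Measure.prod_swap, show (Prod.swap : X × X → X × X) = MeasurableEquiv.prodComm from rfl,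
    lintegral_map_equiv]
  exact lintegral_congr fun p => hκ.1 _ _

theorem lowerSemicontinuous_measure_section {ν : Measure X} [ν.Regular]
    {W : Set (X × X)} (hW : IsOpen W) :
    LowerSemicontinuous fun x => ν (Prod.mk x ⁻¹' W) := by
  intro x t ht
  obtain ⟨C, hCW, hC, htC⟩ := (hW.preimage (Continuous.prodMk_right x)).exists_lt_isCompact ht
  obtain ⟨U, V, hU, -, hxU, hCV, hUV⟩ := generalized_tube_lemma (isCompact_singleton (x := x)) hC hW
    (by rintro ⟨a, b⟩ ⟨rfl, hb⟩; exact hCW hb)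
  filter_upwards [hU.mem_nhds (hxU rfl)] with x' hx'
  exact htC.trans_le (measure_mono fun y hy => hUV ⟨hx', hCV hy⟩)

theorem exists_nnrat_btwn {a b : ℝ≥0∞} (h : a < b) :
    ∃ q : NNRat, a < ((q : ℝ≥0) : ℝ≥0∞) ∧ ((q : ℝ≥0) : ℝ≥0∞) < b := by
  obtain ⟨q, hq0, hq1, hq2⟩ := ENNReal.lt_iff_exists_rat_btwn.1 h
  lift q to NNRat using hq0
  have hcast : Real.toNNReal ((q : ℚ) : ℝ) = (q : ℝ≥0) := by
    ext
    rw [Real.coe_toNNReal _ (by positivity)]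
    norm_cast
  rw [hcast] at hq1 hq2
  exact ⟨q, hq1, hq2⟩

theorem staircase_le (g c : ℝ≥0∞) :
    ∑' k : ℕ, (if (k + 1) * c < g then c else 0) ≤ g := by
  have h : ∀ n : ℕ, ∑ k ∈ Finset.range n, (if ((k : ℝ≥0∞) + 1) * c < g then c else 0) ≤ n * c ∧
      ∑ k ∈ Finset.range n, (if ((k : ℝ≥0∞) + 1) * c < g then c else 0) ≤ g := by
    intro n
    induction n with
    | zero => simp
    | succ n ih =>
      rw [Finset.sum_range_succ]
      split_ifs with hn
      · have : ∑ k ∈ Finset.range n, (if ((k : ℝ≥0∞) + 1) * c < g then c else 0) + c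
            ≤ (n + 1) * c := by
          rw [add_mul, one_mul]; gcongr; exact ih.1
        exact ⟨by push_cast; exact this, this.trans hn.le⟩
      · simp only [add_zero]
        exact ⟨ih.1.trans (by gcongr; simp), ih.2⟩
  rw [ENNReal.tsum_eq_iSup_nat]
  exact iSup_le fun n => (h n).2

theorem le_staircase_add (g c : ℝ≥0∞) (hc : c ≠ 0) :
    g ≤ ∑' k : ℕ, (if (k + 1) * c < g then c else 0) + c := by
  have h : ∀ n : ℕ, min g ((n + 1) * c) ≤
      ∑ k ∈ Finset.range n, (if ((k : ℝ≥0∞) + 1) * c < g then c else 0) + c := by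
    intro n
    induction n with
    | zero => simp
    | succ n ih =>
      rw [Finset.sum_range_succ]
      split_ifs with hn
      · rw [min_eq_right hn.le] at ih
        refine (min_le_right _ _).trans ?_
        push_cast
        rw [add_mul _ _ c, one_mul]
        gcongr
      · rw [min_eq_left (not_lt.1 hn)] at ih
        simpa using (min_le_left _ _).trans ih
  refine le_of_forall_lt fun a ha => ?_
  obtain ⟨n, hn⟩ : ∃ n : ℕ, a < (n + 1) * c := by
    obtain ⟨n, hn⟩ := ENNReal.exists_nat_mul_gt hc ha.ne_top
    exact ⟨n, hn.trans_le (by gcongr; simp)⟩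
  exact (lt_min ha hn).trans_le ((h n).trans (by gcongr; exact ENNReal.sum_le_tsum _))

variable [BorelSpace X] {κ : X → X → ℝ≥0∞}

theorem lowerSemicontinuous_potential (hκ : IsKernel κ) (ν : Measure X) [IsFiniteMeasure ν]
    [ν.Regular] : LowerSemicontinuous (potential κ ν) := by
  have hm : ∀ x, Measurable (κ x) := fun x => (hκ.lowerSemicontinuous_right x).measurable
  have hint : ∀ (c : ℝ≥0∞) x, ∫⁻ y, ∑' k : ℕ, (if (k + 1) * c < κ x y then c else 0) ∂ν
      = ∑' k : ℕ, c * ν (Prod.mk x ⁻¹' {p | (k + 1) * c < κ p.1 p.2}) := by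
    intro c x
    have hms : ∀ k : ℕ, MeasurableSet {y | (k + 1) * c < κ x y} := fun k =>
      measurableSet_lt measurable_const (hm x)
    rw [lintegral_tsum fun k =>
      (Measurable.ite (hms k) measurable_const measurable_const).aemeasurable]
    congr 1 with k
    have : (fun y => if (k + 1) * c < κ x y then c else 0)
        = indicator {y | (k + 1) * c < κ x y} fun _ => c := by
      ext y; simp [indicator]
    rw [this, lintegral_indicator_const (hms k)]; rfl
  have key : potential κ ν = fun x => ⨆ n : ℕ,
      ∑' k : ℕ, (n + 1 : ℝ≥0∞)⁻¹ *
        ν (Prod.mk x ⁻¹' {p | (k + 1) * (n + 1 : ℝ≥0∞)⁻¹ < κ p.1 p.2}) := by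
    ext x
    simp_rw [← hint]
    refine le_antisymm ?_ (iSup_le fun n => lintegral_mono fun y => staircase_le _ _)
    have hle : ∀ n : ℕ, potential κ ν x ≤
        (⨆ n : ℕ, ∫⁻ y, ∑' k : ℕ, (if (k + 1) * (n + 1 : ℝ≥0∞)⁻¹ < κ x y
          then (n + 1 : ℝ≥0∞)⁻¹ else 0) ∂ν) + (n + 1 : ℝ≥0∞)⁻¹ * ν univ := by
      intro n
      calc potential κ ν x
          ≤ ∫⁻ y, (∑' k : ℕ, (if (k + 1) * (n + 1 : ℝ≥0∞)⁻¹ < κ x y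
          then (n + 1 : ℝ≥0∞)⁻¹ else 0)) + (n + 1 : ℝ≥0∞)⁻¹ ∂ν :=
            lintegral_mono fun y => le_staircase_add _ _ (by simp)
        _ ≤ _ := by
            rw [lintegral_add_right _ measurable_const, lintegral_const]
            gcongr
            exact le_iSup (fun n : ℕ => ∫⁻ y, ∑' k : ℕ, (if (k + 1) * (n + 1 : ℝ≥0∞)⁻¹ < κ x y
              then (n + 1 : ℝ≥0∞)⁻¹ else 0) ∂ν) n
    have hlim : Tendsto (fun n : ℕ => (⨆ n : ℕ, ∫⁻ y, ∑' k : ℕ,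
        (if (k + 1) * (n + 1 : ℝ≥0∞)⁻¹ < κ x y
          then (n + 1 : ℝ≥0∞)⁻¹ else 0) ∂ν) + (n + 1 : ℝ≥0∞)⁻¹ * ν univ) atTop
        (𝓝 ((⨆ n : ℕ, ∫⁻ y, ∑' k : ℕ, (if (k + 1) * (n + 1 : ℝ≥0∞)⁻¹ < κ x y
          then (n + 1 : ℝ≥0∞)⁻¹ else 0) ∂ν) + 0 * ν univ)) := by
      refine tendsto_const_nhds.add (ENNReal.Tendsto.mul_const ?_ (Or.inr (measure_ne_top _ _)))
      have := (tendsto_add_atTop_iff_nat 1).2 ENNReal.tendsto_inv_nat_nhds_zero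
      simpa using this
    simpa using ge_of_tendsto' hlim hle
  rw [key]
  refine lowerSemicontinuous_iSup fun n => lowerSemicontinuous_tsum fun k => ?_
  have := lowerSemicontinuous_measure_section (ν := ν)
    (hκ.2.isOpen_preimage ((k + 1) * (n + 1 : ℝ≥0∞)⁻¹))
  exact (ENNReal.continuous_const_mul (by simp)).comp_lowerSemicontinuous this
    fun a b h => by dsimp; gcongr

variable [T2Space X]

/-- Any open set of the product has a subset measurable for the product σ-algebra, with
almost all sections of full measure. -/
theorem exists_measurableSet_subset_section_ae_eq (μ ν : Measure X) [IsFiniteMeasure μ]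
    [μ.Regular] [IsFiniteMeasure ν] [ν.Regular] {W : Set (X × X)} (hW : IsOpen W) :
    ∃ W' ⊆ W, MeasurableSet W' ∧ ∀ᵐ x ∂μ, ∀ᵐ y ∂ν, (x, y) ∈ W → (x, y) ∈ W' := by
  have hlsc := lowerSemicontinuous_measure_section (ν := ν) hW
  have hloc : ∀ (t : ℝ≥0∞) (C : Set X), IsCompact C → (∀ x ∈ C, t < ν (Prod.mk x ⁻¹' W)) →
      ∃ W' ⊆ W, MeasurableSet W' ∧ ∀ x ∈ C, t < ν (Prod.mk x ⁻¹' W') := by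
    intro t C hC hCt
    have : ∀ x ∈ C, ∃ U V, IsOpen U ∧ IsOpen V ∧ x ∈ U ∧ U ×ˢ V ⊆ W ∧ t < ν V := by
      intro x hx
      obtain ⟨D, hDW, hD, htD⟩ :=
        (hW.preimage (Continuous.prodMk_right x)).exists_lt_isCompact (hCt x hx)
      obtain ⟨U, V, hU, hV, hxU, hDV, hUV⟩ :=
        generalized_tube_lemma (isCompact_singleton (x := x)) hD hW
          (by rintro ⟨a, b⟩ ⟨rfl, hb⟩; exact hDW hb)
      exact ⟨U, V, hU, hV, hxU rfl, hUV, htD.trans_le (measure_mono hDV)⟩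
    choose! U V hU hV hxU hUV htV using this
    obtain ⟨s, hsC, hs⟩ := hC.elim_nhds_subcover U fun x hx => (hU x hx).mem_nhds (hxU x hx)
    refine ⟨⋃ x ∈ s, U x ×ˢ V x, iUnion₂_subset fun x hx => hUV x (hsC x hx),
      s.measurableSet_biUnion fun x hx =>
        (hU x (hsC x hx)).measurableSet.prod (hV x (hsC x hx)).measurableSet, fun x hx => ?_⟩
    obtain ⟨z, hz, hxz⟩ := mem_iUnion₂.1 (hs hx)
    exact (htV z (hsC z hz)).trans_le
      (measure_mono fun y hy => mem_iUnion₂.2 ⟨z, hz, hxz, hy⟩)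
  have hGm : ∀ t, MeasurableSet {x | t < ν (Prod.mk x ⁻¹' W)} := fun t =>
    (hlsc.isOpen_preimage t).measurableSet
  have hcomp : ∀ (t : ℝ≥0∞) (n : ℕ), ∃ C ⊆ {x | t < ν (Prod.mk x ⁻¹' W)}, IsCompact C ∧
      μ ({x | t < ν (Prod.mk x ⁻¹' W)} \ C) ≤ (n + 1 : ℝ≥0∞)⁻¹ := by
    intro t n
    obtain ⟨C, hCs, hC, -, hlt⟩ := (hGm t).exists_isCompact_isClosed_sdiff_lt
      (measure_ne_top μ _) (ε := (n + 1 : ℝ≥0∞)⁻¹) (by simp)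
    exact ⟨C, hCs, hC, hlt.le⟩
  choose C hCs hC hClt using hcomp
  choose W' hW'W hW'm hW't using fun t n => hloc t (C t n) (hC t n) (hCs t n)
  refine ⟨⋃ (q : NNRat) (n : ℕ), W' (((q : ℝ≥0)) : ℝ≥0∞) n,
    iUnion₂_subset fun q n => hW'W _ _, MeasurableSet.iUnion fun q => MeasurableSet.iUnion fun n =>
      hW'm _ _, ?_⟩
  have hnull : ∀ q : NNRat, ∀ᵐ x ∂μ, ((q : ℝ≥0) : ℝ≥0∞) < ν (Prod.mk x ⁻¹' W) →
      ∃ n, x ∈ C ((q : ℝ≥0) : ℝ≥0∞) n := by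
    intro q
    rw [ae_iff]
    refine le_antisymm (ge_of_tendsto' (x := atTop) (f := fun n : ℕ => (n + 1 : ℝ≥0∞)⁻¹) ?_ ?_)
      zero_le
    · have := (tendsto_add_atTop_iff_nat 1).2 ENNReal.tendsto_inv_nat_nhds_zero
      simpa using this
    · intro n
      refine (measure_mono ?_).trans (hClt ((q : ℝ≥0) : ℝ≥0∞) n)
      intro x hx
      simp only [mem_ofPred_eq, Classical.not_imp, not_exists] at hx
      exact ⟨hx.1, hx.2 n⟩
  filter_upwards [ae_all_iff.2 hnull] with x hx
  have hsub : Prod.mk x ⁻¹' (⋃ (q : NNRat) (n : ℕ), W' ((q : ℝ≥0) : ℝ≥0∞) n)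
      ⊆ Prod.mk x ⁻¹' W := preimage_mono (iUnion₂_subset fun q n => hW'W _ _)
  have hms : MeasurableSet (Prod.mk x ⁻¹' (⋃ (q : NNRat) (n : ℕ), W' ((q : ℝ≥0) : ℝ≥0∞) n)) :=
    measurable_prodMk_left (MeasurableSet.iUnion fun q => MeasurableSet.iUnion fun n =>
      hW'm _ _)
  have hle : ν (Prod.mk x ⁻¹' W) ≤
      ν (Prod.mk x ⁻¹' (⋃ (q : NNRat) (n : ℕ), W' ((q : ℝ≥0) : ℝ≥0∞) n)) := by
    by_contra! hlt
    obtain ⟨q, hq1, hq2⟩ := exists_nnrat_btwn hlt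
    obtain ⟨n, hn⟩ := hx q hq2
    exact lt_irrefl _ (((hW't _ n x hn).trans_le (measure_mono (preimage_mono
      (subset_iUnion₂ (s := fun (q : NNRat) (n : ℕ) => W' ((q : ℝ≥0) : ℝ≥0∞) n) q n)))).trans hq1)
  have hae := ae_eq_of_subset_of_measure_ge hsub hle hms.nullMeasurableSet (measure_ne_top ν _)
  filter_upwards [hae.mem_iff] with y hy
  exact hy.2

theorem exists_measurable_le_ae_eq (hκ : IsKernel κ) (μ ν : Measure X) [IsFiniteMeasure μ]
    [μ.Regular] [IsFiniteMeasure ν] [ν.Regular] :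
    ∃ g : X × X → ℝ≥0∞, Measurable g ∧ (∀ p, g p ≤ κ p.1 p.2) ∧
      ∀ᵐ x ∂μ, ∀ᵐ y ∂ν, g (x, y) = κ x y := by
  choose W hWs hWm hW using fun q : NNRat => exists_measurableSet_subset_section_ae_eq μ ν
    (hκ.2.isOpen_preimage ((q : ℝ≥0) : ℝ≥0∞))
  refine ⟨fun p => ⨆ q : NNRat, (W q).indicator (fun _ => ((q : ℝ≥0) : ℝ≥0∞)) p,
    Measurable.iSup fun q => measurable_const.indicator (hWm q), fun p => iSup_le fun q => ?_, ?_⟩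
  · exact indicator_apply_le' (fun h => (hWs q h).le) fun _ => zero_le
  · filter_upwards [ae_all_iff.2 hW] with x hx
    filter_upwards [ae_all_iff.2 hx] with y hy
    refine le_antisymm (iSup_le fun q => indicator_apply_le' (fun h => (hWs q h).le)
      fun _ => zero_le) (le_of_forall_lt fun a ha => ?_)
    obtain ⟨q, hq1, hq2⟩ := exists_nnrat_btwn ha
    refine hq1.trans_le (le_iSup_of_le q ?_)
    rw [indicator_of_mem (hy q hq2)]

theorem mutualEnergy_eq_lintegral_potential (hκ : IsKernel κ) (μ ν : Measure X)
    [IsFiniteMeasure μ] [μ.Regular] [IsFiniteMeasure ν] [ν.Regular] :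
    mutualEnergy κ μ ν = ∫⁻ x, potential κ ν x ∂μ := by
  apply le_antisymm
  · exact lintegral_prod_le _
  · obtain ⟨g, hgm, hgle, hg⟩ := exists_measurable_le_ae_eq hκ μ ν
    calc ∫⁻ x, potential κ ν x ∂μ = ∫⁻ x, ∫⁻ y, g (x, y) ∂ν ∂μ :=
          lintegral_congr_ae (hg.mono fun x hx => (lintegral_congr_ae hx).symm)
      _ = ∫⁻ p, g p ∂(μ.prod ν) := (lintegral_prod _ hgm.aemeasurable).symm
      _ ≤ _ := lintegral_mono hgle

end Sections

section EnergyAlgebra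

set_option linter.unusedSectionVars false

open scoped NNReal

/-- The finite measures of `E⁺`. -/
structure FinEn (κ : X → X → ℝ≥0∞) (μ : Measure X) : Prop where
  isFinite : IsFiniteMeasure μ
  regular : μ.Regular
  energy_lt_top : energy κ μ < ⊤

/-- The finite measures of `E⁺(A)`. -/
def FinEnOn (κ : X → X → ℝ≥0∞) (A : Set X) (μ : Measure X) : Prop :=
  FinEn κ μ ∧ μ Aᶜ = 0

/-- The mutual energy as a real number. -/
def inn (κ : X → X → ℝ≥0∞) (μ ν : Measure X) : ℝ := (mutualEnergy κ μ ν).toReal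

variable {κ : X → X → ℝ≥0∞} {μ ν σ ζ : Measure X} {A K : Set X}

theorem FinEn.memEplus (h : FinEn κ μ) : memEplus κ μ := ⟨h.regular, h.energy_lt_top⟩

theorem FinEn.mutualEnergy_lt_top (hE : EnergyPrinciple κ) (hμ : FinEn κ μ) (hν : FinEn κ ν) :
    mutualEnergy κ μ ν < ⊤ := by
  have h := (hE μ ν hμ.memEplus hν.memEplus).1
  have h2 := h.trans_lt (ENNReal.add_lt_top.2 ⟨hμ.energy_lt_top, hν.energy_lt_top⟩)
  exact lt_top_of_mul_ne_top_right h2.ne (by simp)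

theorem mutualEnergy_add_left [IsFiniteMeasure μ] [IsFiniteMeasure ν] [IsFiniteMeasure σ] :
    mutualEnergy κ (μ + ν) σ = mutualEnergy κ μ σ + mutualEnergy κ ν σ := by
  rw [mutualEnergy, Measure.add_prod, lintegral_add_measure]; rfl

theorem mutualEnergy_smul_left [IsFiniteMeasure ν] (c : ℝ≥0) :
    mutualEnergy κ (c • μ) ν = c * mutualEnergy κ μ ν := by
  rw [mutualEnergy, Measure.prod_smul_left, lintegral_smul_measure]; rfl

theorem mutualEnergy_restrict_le [IsFiniteMeasure μ] [IsFiniteMeasure ν] (S T : Set X) :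
    mutualEnergy κ (μ.restrict S) (ν.restrict T) ≤ mutualEnergy κ μ ν :=
  lintegral_mono' (Measure.prod_mono Measure.restrict_le_self Measure.restrict_le_self) le_rfl

theorem FinEn.zero : FinEn κ 0 :=
  ⟨inferInstance, inferInstance, by simp [energy, mutualEnergy]⟩

theorem inn_comm (hκ : IsKernel κ) (hμ : FinEn κ μ) (hν : FinEn κ ν) :
    inn κ μ ν = inn κ ν μ := by
  have := hμ.isFinite
  have := hν.isFinite
  rw [inn, mutualEnergy_comm hκ, inn]

theorem FinEn.inn_add_left (hE : EnergyPrinciple κ) (hμ : FinEn κ μ) (hν : FinEn κ ν)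
    (hσ : FinEn κ σ) : inn κ (μ + ν) σ = inn κ μ σ + inn κ ν σ := by
  have := hμ.isFinite
  have := hν.isFinite
  have := hσ.isFinite
  rw [inn, mutualEnergy_add_left, ENNReal.toReal_add (hμ.mutualEnergy_lt_top hE hσ).ne
    (hν.mutualEnergy_lt_top hE hσ).ne]; rfl

theorem FinEn.inn_smul_left (hν : FinEn κ ν) (c : ℝ≥0) : inn κ (c • μ) ν = c * inn κ μ ν := by
  have := hν.isFinite
  rw [inn, mutualEnergy_smul_left, ENNReal.toReal_mul]; rfl

theorem FinEn.smul (hκ : IsKernel κ) (hμ : FinEn κ μ) (c : ℝ≥0) : FinEn κ (c • μ) := by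
  have := hμ.isFinite
  have := hμ.regular
  refine ⟨inferInstance, inferInstance, ?_⟩
  rw [energy, mutualEnergy_smul_left, mutualEnergy_comm hκ, mutualEnergy_smul_left]
  exact ENNReal.mul_lt_top ENNReal.coe_lt_top
    (ENNReal.mul_lt_top ENNReal.coe_lt_top hμ.energy_lt_top)

theorem FinEn.inn_smul_right (hκ : IsKernel κ) (hμ : FinEn κ μ) (hν : FinEn κ ν) (c : ℝ≥0) :
    inn κ μ (c • ν) = c * inn κ μ ν := by
  rw [inn_comm hκ hμ (hν.smul hκ c), hμ.inn_smul_left, inn_comm hκ hν hμ]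

theorem FinEn.sq_dist_nonneg (hE : EnergyPrinciple κ) (hμ : FinEn κ μ) (hν : FinEn κ ν) :
    0 ≤ inn κ μ μ + inn κ ν ν - 2 * inn κ μ ν := by
  have h := (hE μ ν hμ.memEplus hν.memEplus).1
  have h2 := ENNReal.toReal_mono
    (ENNReal.add_lt_top.2 ⟨hμ.energy_lt_top, hν.energy_lt_top⟩).ne h
  rw [ENNReal.toReal_mul, ENNReal.toReal_add hμ.energy_lt_top.ne hν.energy_lt_top.ne] at h2
  change 2 * inn κ μ ν ≤ inn κ μ μ + inn κ ν ν at h2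
  linarith

theorem FinEn.eq_of_sq_dist_nonpos (hE : EnergyPrinciple κ) (hμ : FinEn κ μ) (hν : FinEn κ ν)
    (h : inn κ μ μ + inn κ ν ν - 2 * inn κ μ ν ≤ 0) : μ = ν := by
  refine (hE μ ν hμ.memEplus hν.memEplus).2 ?_
  rw [← ENNReal.toReal_eq_toReal_iff' (ENNReal.mul_lt_top (by simp)
      (hμ.mutualEnergy_lt_top hE hν)).ne
    (ENNReal.add_lt_top.2 ⟨hμ.energy_lt_top, hν.energy_lt_top⟩).ne,
    ENNReal.toReal_mul, ENNReal.toReal_add hμ.energy_lt_top.ne hν.energy_lt_top.ne]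
  change 2 * inn κ μ ν = inn κ μ μ + inn κ ν ν
  linarith [hμ.sq_dist_nonneg hE hν]

theorem FinEn.strongDist_sq (hE : EnergyPrinciple κ) (hμ : FinEn κ μ) (hν : FinEn κ ν) :
    strongDist κ μ ν ^ 2 = inn κ μ μ + inn κ ν ν - 2 * inn κ μ ν :=
  Real.sq_sqrt (hμ.sq_dist_nonneg hE hν)

variable [BorelSpace X] [T2Space X]

theorem FinEn.restrict (hμ : FinEn κ μ) (S : Set X) : FinEn κ (μ.restrict S) := by
  have := hμ.isFinite
  have := hμ.regular
  exact ⟨inferInstance, inferInstance,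
    (mutualEnergy_restrict_le S S).trans_lt hμ.energy_lt_top⟩

theorem FinEn.add (hκ : IsKernel κ) (hE : EnergyPrinciple κ) (hμ : FinEn κ μ)
    (hν : FinEn κ ν) : FinEn κ (μ + ν) := by
  have := hμ.isFinite
  have := hν.isFinite
  have := hμ.regular
  have := hν.regular
  refine ⟨inferInstance, inferInstance, ?_⟩
  rw [energy, mutualEnergy_add_left, mutualEnergy_comm hκ, mutualEnergy_add_left,
    mutualEnergy_comm hκ ν (μ + ν), mutualEnergy_add_left]
  simp only [ENNReal.add_lt_top]
  exact ⟨⟨hμ.energy_lt_top, hν.mutualEnergy_lt_top hE hμ⟩, hμ.mutualEnergy_lt_top hE hν,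
    hν.energy_lt_top⟩

theorem FinEn.inn_add_right (hκ : IsKernel κ) (hE : EnergyPrinciple κ) (hσ : FinEn κ σ)
    (hμ : FinEn κ μ) (hν : FinEn κ ν) : inn κ σ (μ + ν) = inn κ σ μ + inn κ σ ν := by
  rw [inn_comm hκ hσ (hμ.add hκ hE hν), hμ.inn_add_left hE hν hσ, inn_comm hκ hσ hμ,
    inn_comm hκ hσ hν]

/-- The Cauchy–Schwarz inequality for the energy. -/
theorem FinEn.sq_inn_sub_le (hκ : IsKernel κ) (hE : EnergyPrinciple κ) (hμ : FinEn κ μ)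
    (hν : FinEn κ ν) (hσ : FinEn κ σ) :
    (inn κ μ σ - inn κ ν σ) ^ 2 ≤
      (inn κ μ μ + inn κ ν ν - 2 * inn κ μ ν) * inn κ σ σ := by
  have key : ∀ t : ℝ, 0 ≤ inn κ σ σ * (t * t) + (2 * (inn κ μ σ - inn κ ν σ)) * t +
      (inn κ μ μ + inn κ ν ν - 2 * inn κ μ ν) := by
    have pos : ∀ {μ ν : Measure X}, FinEn κ μ → FinEn κ ν → ∀ t : ℝ≥0,
        0 ≤ inn κ σ σ * ((t : ℝ) * t) + (2 * (inn κ μ σ - inn κ ν σ)) * t +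
        (inn κ μ μ + inn κ ν ν - 2 * inn κ μ ν) := by
      intro μ ν hμ hν t
      have hs := hσ.smul hκ t
      have h := (hμ.add hκ hE hs).sq_dist_nonneg hE hν
      rw [hμ.inn_add_left hE hs (hμ.add hκ hE hs), hμ.inn_add_left hE hs hν,
        hμ.inn_add_right hκ hE hμ hs, hs.inn_add_right hκ hE hμ hs, hs.inn_smul_left,
        hμ.inn_smul_left, hν.inn_smul_left, hμ.inn_smul_right hκ hσ,
        hσ.inn_smul_right hκ hσ, inn_comm hκ hσ hμ, inn_comm hκ hσ hν] at h
      linarith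
    intro t
    rcases le_total 0 t with ht | ht
    · lift t to ℝ≥0 using ht
      exact pos hμ hν t
    · have h := pos hν hμ (-t).toNNReal
      rw [inn_comm hκ hν hμ, Real.coe_toNNReal _ (by linarith)] at h
      linarith
  have := discrim_le_zero key
  rw [discrim] at this
  linarith

theorem FinEn.mutualEnergy_eq (hκ : IsKernel κ) (hμ : FinEn κ μ) (hν : FinEn κ ν) :
    mutualEnergy κ μ ν = ∫⁻ x, potential κ μ x ∂ν := by
  have := hμ.isFinite
  have := hν.isFinite
  have := hμ.regular
  have := hν.regular
  rw [mutualEnergy_comm hκ, mutualEnergy_eq_lintegral_potential hκ]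

theorem FinEn.lowerSemicontinuous_potential (hκ : IsKernel κ) (hμ : FinEn κ μ) :
    LowerSemicontinuous (potential κ μ) := by
  have := hμ.isFinite
  have := hμ.regular
  exact GaussVar.lowerSemicontinuous_potential hκ μ

theorem FinEn.ae_potential_lt_top (hκ : IsKernel κ) (hE : EnergyPrinciple κ) (hμ : FinEn κ μ)
    (hν : FinEn κ ν) : ∀ᵐ x ∂ν, potential κ μ x < ⊤ :=
  ae_lt_top (hμ.lowerSemicontinuous_potential hκ).measurable
    (by rw [← hμ.mutualEnergy_eq hκ hν]; exact (hμ.mutualEnergy_lt_top hE hν).ne)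

theorem FinEn.concentrated_iff (hμ : FinEn κ μ) : Concentrated μ A ↔ μ Aᶜ = 0 := by
  have := hμ.isFinite
  have := hμ.regular
  refine ⟨fun h => ?_, fun h K _ => measure_mono_null inter_subset_left h⟩
  refine le_antisymm (ENNReal.le_of_forall_pos_le_add fun ε hε _ => ?_) zero_le
  obtain ⟨K, -, hK, -, hlt⟩ := (MeasurableSet.univ (α := X)).exists_isCompact_isClosed_sdiff_lt
    (measure_ne_top μ _) (ε := (ε : ℝ≥0∞)) (by simpa using hε.ne')
  calc μ Aᶜ ≤ μ (Aᶜ ∩ K) + μ (univ \ K) :=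
        (measure_mono fun x hx => by by_cases hxK : x ∈ K <;> simp_all).trans (measure_union_le _ _)
    _ ≤ 0 + ε := by gcongr; exact (h K hK).le

theorem memBreve_iff (hμ : μ univ = 1) : memBreve κ A μ ↔ FinEnOn κ A μ := by
  refine ⟨fun h => ?_, fun h => ⟨h.1.memEplus, h.1.concentrated_iff.2 h.2, hμ⟩⟩
  have hF : FinEn κ μ := ⟨⟨by simp [hμ]⟩, h.1.1, h.1.2⟩
  exact ⟨hF, hF.concentrated_iff.1 h.2.1⟩

theorem FinEnOn.restrict (hμ : FinEnOn κ A μ) (S : Set X) : FinEnOn κ A (μ.restrict S) :=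
  ⟨hμ.1.restrict S, Measure.absolutelyContinuous_of_le Measure.restrict_le_self hμ.2⟩

theorem FinEnOn.smul (hκ : IsKernel κ) (hμ : FinEnOn κ A μ) (c : ℝ≥0) : FinEnOn κ A (c • μ) :=
  ⟨hμ.1.smul hκ c, by simp [hμ.2]⟩

theorem FinEnOn.add (hκ : IsKernel κ) (hE : EnergyPrinciple κ) (hμ : FinEnOn κ A μ)
    (hν : FinEnOn κ A ν) : FinEnOn κ A (μ + ν) :=
  ⟨hμ.1.add hκ hE hν.1, by simp [hμ.2, hν.2]⟩

theorem FinEnOn.mono {B : Set X} (hμ : FinEnOn κ A μ) (hAB : A ⊆ B) : FinEnOn κ B μ :=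
  ⟨hμ.1, measure_mono_null (compl_subset_compl.2 hAB) hμ.2⟩

theorem FinEnOn.memBreve_smul (hκ : IsKernel κ) (hμ : FinEnOn κ A μ) (h0 : μ univ ≠ 0) :
    memBreve κ A ((μ univ).toNNReal⁻¹ • μ) := by
  have := hμ.1.isFinite
  refine (memBreve_iff ?_).2 (hμ.smul hκ _)
  rw [Measure.smul_apply, ENNReal.smul_def, ENNReal.coe_inv (by
    simpa [ENNReal.toNNReal_eq_zero_iff] using h0), ENNReal.coe_toNNReal (measure_ne_top _ _)]
  exact ENNReal.inv_mul_cancel h0 (measure_ne_top _ _)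

theorem FinEn.restrict_of_memEplus (hE : EnergyPrinciple κ) (hμ : GaussVar.memEplus κ μ)
    (hK : IsCompact K) : FinEn κ (μ.restrict K) := by
  have := hμ.1
  unfold IsRadon at this
  have hf : IsFiniteMeasure (μ.restrict K) := ⟨by simpa using hK.measure_lt_top⟩
  refine ⟨hf, inferInstance, ?_⟩
  by_cases h : AEMeasurable (fun x => Measure.map (Prod.mk x) μ) μ
  · refine lt_of_le_of_lt (lintegral_mono' (Measure.le_iff.2 fun s hs => ?_) le_rfl) hμ.2
    rw [Measure.prod_apply hs, Measure.prod_def, Measure.bind_apply hs h]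
    refine lintegral_mono' Measure.restrict_le_self fun x => ?_
    rw [Measure.map_apply measurable_prodMk_left hs]
    exact Measure.restrict_le_self _
  · have h0 : μ.prod μ = 0 := by
      rw [Measure.prod_def, Measure.bind, Measure.map_of_not_aemeasurable h, Measure.join_zero]
    have : μ = 0 := (hE μ 0 hμ FinEn.zero.memEplus).2
      (by simp [energy, mutualEnergy, h0])
    simp [this, energy, mutualEnergy]

/-- Comparison of potentials almost everywhere follows from comparison of mutual energies. -/
theorem ae_le_of_forall_lintegral_le {g h : X → ℝ≥0∞} (hg : Measurable g)
    (hgh : ∀ ν, FinEnOn κ A ν → ∫⁻ x, g x ∂ν ≤ ∫⁻ x, h x ∂ν) (hν : FinEnOn κ A ν) :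
    ∀ᵐ x ∂ν, g x ≤ h x := by
  have := hν.1.isFinite
  exact ae_le_of_forall_setLIntegral_le_of_sigmaFinite hg fun s _ _ => hgh _ (hν.restrict s)

/-- Sets of inner capacity zero are negligible for measures of finite energy. -/
theorem measure_eq_zero_of_innerCap_eq_zero (hκ : IsKernel κ) (hν : FinEnOn κ A ν) {S : Set X}
    (hS : MeasurableSet S) {N : Set X} (hSN : A ∩ S ⊆ N) (hN : innerCap κ N = 0) : ν S = 0 := by
  have := hν.1.isFinite
  have := hν.1.regular
  by_contra h0
  have hT := measurableSet_toMeasurable ν Aᶜ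
  have h1 : ν (S \ toMeasurable ν Aᶜ) ≠ 0 := by
    rwa [measure_sdiff_null (by rw [measure_toMeasurable]; exact hν.2)]
  have h2 : FinEnOn κ N (ν.restrict (S \ toMeasurable ν Aᶜ)) := by
    refine ⟨hν.1.restrict _, measure_mono_null (t := (S \ toMeasurable ν Aᶜ)ᶜ)
      (compl_subset_compl.2 fun x hx => hSN ⟨?_, hx.1⟩) ?_⟩
    · by_contra hxA
      exact hx.2 (subset_toMeasurable ν Aᶜ hxA)
    · rw [Measure.restrict_apply (hS.diff hT).compl]; simp
  have h3 := h2.memBreve_smul hκ (by simpa using h1)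
  have h4 : wcap κ N < ⊤ := lt_of_le_of_lt (iInf₂_le _ h3) h3.1.2
  rw [innerCap, ENNReal.inv_eq_zero] at hN
  exact h4.ne hN

end EnergyAlgebra

section Existence

open scoped NNReal

variable {κ : X → X → ℝ≥0∞} {μ ν σ ζ : Measure X} {A K : Set X} [BorelSpace X] [T2Space X]

/-- The first variation of `ν ↦ I(ν) - 2 I(ζ,ν)` at a minimizer over a convex set. -/
theorem FinEn.first_variation (hκ : IsKernel κ) (hE : EnergyPrinciple κ) (hζ : FinEn κ ζ)
    (hμ : FinEn κ μ) (hν : FinEn κ ν)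
    (h : ∀ a b : ℝ≥0, a + b = 1 → inn κ μ μ - 2 * inn κ ζ μ ≤
      inn κ (a • μ + b • ν) (a • μ + b • ν) - 2 * inn κ ζ (a • μ + b • ν)) :
    inn κ μ μ - inn κ ζ μ ≤ inn κ μ ν - inn κ ζ ν := by
  by_contra! hlt
  have hD := hμ.sq_dist_nonneg hE hν
  have hD1 : 0 < inn κ μ μ + inn κ ν ν - 2 * inn κ μ ν + 1 := by linarith
  obtain ⟨s, hs⟩ : ∃ s, s = (inn κ μ μ - inn κ ζ μ) - (inn κ μ ν - inn κ ζ ν) := ⟨_, rfl⟩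
  have hs0 : 0 < s := by linarith
  obtain ⟨b, hb0, hb1, hbs⟩ : ∃ b : ℝ, 0 < b ∧ b ≤ 1 ∧
      b * (inn κ μ μ + inn κ ν ν - 2 * inn κ μ ν + 1) ≤ s :=
    ⟨min 1 (s / (inn κ μ μ + inn κ ν ν - 2 * inn κ μ ν + 1)), by positivity, min_le_left _ _,
      (mul_le_mul_of_nonneg_right (min_le_right _ _) hD1.le).trans
        (div_mul_cancel₀ _ hD1.ne').le⟩
  obtain ⟨a, ha⟩ : ∃ a : ℝ, a = 1 - b := ⟨_, rfl⟩
  have ha0 : 0 ≤ a := by linarith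
  have hb0' := hb0.le
  lift a to ℝ≥0 using ha0
  lift b to ℝ≥0 using hb0'
  have hab : a + b = 1 := by
    rw [← NNReal.coe_inj]; push_cast; linarith
  have h1 := h a b hab
  have hμa := hμ.smul hκ a
  have hνb := hν.smul hκ b
  rw [hμa.inn_add_left hE hνb (hμa.add hκ hE hνb), hμa.inn_add_right hκ hE hμa hνb,
    hνb.inn_add_right hκ hE hμa hνb, hζ.inn_add_right hκ hE hμa hνb, hμa.inn_smul_left,
    hνb.inn_smul_left, hμa.inn_smul_left, hνb.inn_smul_left, hμ.inn_smul_right hκ hμ,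
    hμ.inn_smul_right hκ hν, hν.inn_smul_right hκ hμ, hν.inn_smul_right hκ hν,
    hζ.inn_smul_right hκ hμ, hζ.inn_smul_right hκ hν, inn_comm hκ hν hμ, ha] at h1
  have h2 : 0 ≤ (b : ℝ) * (b * (inn κ μ μ + inn κ ν ν - 2 * inn κ μ ν) - 2 * s) := by
    rw [hs]; linarith
  have h3 := nonneg_of_mul_nonneg_right h2 hb0
  nlinarith

theorem FinEn.tendsto_inn_left (hκ : IsKernel κ) (hE : EnergyPrinciple κ) {ι : Type*}
    {F : Filter ι} {m : ι → Measure X} (hm : ∀ᶠ i in F, FinEn κ (m i)) (hμ : FinEn κ μ)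
    (h : Tendsto (fun i => inn κ (m i) (m i) + inn κ μ μ - 2 * inn κ (m i) μ) F (𝓝 0))
    (hσ : FinEn κ σ) : Tendsto (fun i => inn κ (m i) σ) F (𝓝 (inn κ μ σ)) := by
  have h1 : Tendsto (fun i => (inn κ (m i) σ - inn κ μ σ) ^ 2) F (𝓝 0) := by
    refine tendsto_of_tendsto_of_tendsto_of_le_of_le' tendsto_const_nhds
      (by simpa using h.mul_const (inn κ σ σ)) (Eventually.of_forall fun i => sq_nonneg _) ?_
    filter_upwards [hm] with i hi using hi.sq_inn_sub_le hκ hE hμ hσ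
  have h2 := h1.sqrt
  simp only [Real.sqrt_sq_eq_abs, Real.sqrt_zero] at h2
  have h3 := (tendsto_zero_iff_abs_tendsto_zero _).2 h2
  simpa using h3.add_const (inn κ μ σ)

theorem FinEn.tendsto_inn_self (hκ : IsKernel κ) (hE : EnergyPrinciple κ) {ι : Type*}
    {F : Filter ι} {m : ι → Measure X} (hm : ∀ᶠ i in F, FinEn κ (m i)) (hμ : FinEn κ μ)
    (h : Tendsto (fun i => inn κ (m i) (m i) + inn κ μ μ - 2 * inn κ (m i) μ) F (𝓝 0)) :
    Tendsto (fun i => inn κ (m i) (m i)) F (𝓝 (inn κ μ μ)) := by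
  have h1 := (h.sub_const (inn κ μ μ)).add ((hμ.tendsto_inn_left hκ hE hm h hμ).const_mul 2)
  convert h1 using 2 <;> ring

theorem measure_compl_eq_zero_of_vagueTendsto [LocallyCompactSpace X] {m : ℕ → Measure X}
    (hμ : IsRadon μ) (hK : IsCompact K) (hm : ∀ n, m n Kᶜ = 0) (h : VagueTendstoSeq m μ) :
    μ Kᶜ = 0 := by
  have := hμ
  unfold IsRadon at this
  rw [hK.isClosed.isOpen_compl.measure_eq_iSup_isCompact μ]
  simp only [ENNReal.iSup_eq_zero]
  intro L hLK hL
  obtain ⟨φ, h1, h0, hc, h01⟩ := exists_continuous_one_zero_of_isCompact hL hK.isClosed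
    (disjoint_compl_left.mono_left hLK)
  have h2 : ∀ n, ∫ x, φ x ∂(m n) = 0 := fun n =>
    integral_eq_zero_of_ae (measure_mono_null (fun x hx hxK => hx (h0 hxK)) (hm n))
  have h3 := h φ φ.continuous hc
  simp only [h2] at h3
  have h4 := tendsto_nhds_unique h3 tendsto_const_nhds
  rw [integral_eq_zero_iff_of_nonneg (fun x => (h01 x).1)
    (φ.continuous.integrable_of_hasCompactSupport hc)] at h4
  refine measure_mono_null (fun x hx => ?_) (ae_iff.1 h4)
  simp [h1 hx]

/-- Over a convex vaguely closed set of measures supported by a compact set, the functional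
`μ ↦ I(μ) - 2 I(ζ,μ)` has a minimizer, at which the first variation is nonnegative. -/
theorem exists_minimizer [LocallyCompactSpace X] (hκ : IsKernel κ) (hp : IsPerfect κ)
    (hK : IsCompact K) (hζ : FinEn κ ζ) {C : Set (Measure X)} (hne : C.Nonempty)
    (hC : ∀ μ ∈ C, FinEnOn κ K μ)
    (hconv : ∀ μ ∈ C, ∀ ν ∈ C, ∀ a b : ℝ≥0, a + b = 1 → a • μ + b • ν ∈ C)
    (hcl : ∀ (m : ℕ → Measure X) (μ : Measure X), (∀ n, m n ∈ C) → FinEnOn κ K μ →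
      VagueTendstoSeq m μ → μ ∈ C) :
    ∃ μ ∈ C, ∀ ν ∈ C, inn κ μ μ - inn κ ζ μ ≤ inn κ μ ν - inn κ ζ ν := by
  obtain ⟨hE, hcompl, hvague⟩ := hp
  let J : Measure X → ℝ := fun μ => inn κ μ μ - 2 * inn κ ζ μ
  have hbdd : BddBelow (J '' C) := by
    refine ⟨-inn κ ζ ζ, ?_⟩
    rintro _ ⟨μ, hμ, rfl⟩
    have := hζ.sq_dist_nonneg hE (hC μ hμ).1
    simp only [J]
    linarith
  have hd : ∀ μ ∈ C, sInf (J '' C) ≤ J μ := fun μ hμ => csInf_le hbdd ⟨μ, hμ, rfl⟩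
  have hseq : ∀ n : ℕ, ∃ μ ∈ C, J μ < sInf (J '' C) + 1 / ((n : ℝ) + 1) := fun n => by
    obtain ⟨_, ⟨μ, hμ, rfl⟩, hlt⟩ := exists_lt_of_csInf_lt (hne.image J)
      (lt_add_of_pos_right (sInf (J '' C)) (Nat.one_div_pos_of_nat (n := n)))
    exact ⟨μ, hμ, hlt⟩
  choose m hmC hmJ using hseq
  have hm : ∀ n, FinEn κ (m n) := fun n => (hC _ (hmC n)).1
  have hD : ∀ i j, inn κ (m i) (m i) + inn κ (m j) (m j) - 2 * inn κ (m i) (m j) ≤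
      2 * (1 / ((i : ℝ) + 1)) + 2 * (1 / ((j : ℝ) + 1)) := by
    intro i j
    obtain ⟨a, ha⟩ : ∃ a : ℝ≥0, (a : ℝ) = 1 / 2 := ⟨1 / 2, by simp⟩
    have h1 := hd _ (hconv _ (hmC i) _ (hmC j) a a
      (by rw [← NNReal.coe_inj]; push_cast; rw [ha]; norm_num))
    have hi := (hm i).smul hκ a
    have hj := (hm j).smul hκ a
    simp only [J] at h1 hmJ
    rw [hi.inn_add_left hE hj (hi.add hκ hE hj), hi.inn_add_right hκ hE hi hj,
      hj.inn_add_right hκ hE hi hj, hζ.inn_add_right hκ hE hi hj, hi.inn_smul_left,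
      hj.inn_smul_left, hi.inn_smul_left, hj.inn_smul_left, (hm i).inn_smul_right hκ (hm i),
      (hm i).inn_smul_right hκ (hm j), (hm j).inn_smul_right hκ (hm i),
      (hm j).inn_smul_right hκ (hm j), hζ.inn_smul_right hκ (hm i),
      hζ.inn_smul_right hκ (hm j), inn_comm hκ (hm j) (hm i), ha] at h1
    have h2 := hmJ i
    have h3 := hmJ j
    linarith
  have hcauchy : StrongCauchySeq κ m := by
    intro ε hε
    obtain ⟨N, hN⟩ := exists_nat_one_div_lt (K := ℝ) (show 0 < ε ^ 2 / 4 by positivity)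
    refine ⟨N, fun i hi j hj => lt_of_pow_lt_pow_left₀ 2 hε.le ?_⟩
    rw [(hm i).strongDist_sq hE (hm j)]
    have h1 := Nat.one_div_le_one_div (α := ℝ) hi
    have h2 := Nat.one_div_le_one_div (α := ℝ) hj
    have h3 := hD i j
    linarith
  obtain ⟨μ, hμ, hlim⟩ := hcompl m (fun n => (hm n).memEplus) hcauchy
  have hv := hvague m μ (fun n => (hm n).memEplus) hμ hlim
  have hμK := measure_compl_eq_zero_of_vagueTendsto hμ.1 hK (fun n => (hC _ (hmC n)).2) hv
  have hfin : FinEnOn κ K μ := by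
    have := hμ.1
    unfold IsRadon at this
    refine ⟨⟨⟨?_⟩, hμ.1, hμ.2⟩, hμK⟩
    rw [← union_compl_self K]
    exact (measure_union_le _ _).trans_lt (by simpa [hμK] using hK.measure_lt_top)
  have hμC := hcl m μ hmC hfin hv
  refine ⟨μ, hμC, fun ν hν => ?_⟩
  have hlim2 := hlim.pow 2
  simp only [(hm _).strongDist_sq hE hfin.1, ne_eq, OfNat.ofNat_ne_zero, not_false_eq_true,
    zero_pow] at hlim2
  have hev : ∀ᶠ n in atTop, FinEn κ (m n) := Eventually.of_forall hm
  have hJ : Tendsto (fun n => J (m n)) atTop (𝓝 (J μ)) := by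
    refine (hfin.1.tendsto_inn_self hκ hE hev hlim2).sub (Tendsto.const_mul 2 ?_)
    have := hfin.1.tendsto_inn_left hκ hE hev hlim2 hζ
    rw [inn_comm hκ hfin.1 hζ] at this
    exact this.congr fun n => inn_comm hκ (hm n) hζ
  have hJμ : J μ ≤ sInf (J '' C) := by
    refine le_of_tendsto_of_tendsto' hJ ?_ fun n => (hmJ n).le
    simpa using (tendsto_const_nhds (x := sInf (J '' C))).add
      (tendsto_one_div_add_atTop_nhds_zero_nat (𝕜 := ℝ))
  exact hζ.first_variation hκ hE hfin.1 (hC ν hν).1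
    fun a b hab => hJμ.trans (hd _ (hconv _ hμC _ hν a b hab))

end Existence

section Equilibrium

set_option linter.unusedSectionVars false

open scoped NNReal

variable {κ : X → X → ℝ≥0∞} {μ ν σ ζ γ : Measure X} {A K : Set X}

theorem potential_smul (c : ℝ≥0) (x : X) : potential κ (c • μ) x = c * potential κ μ x := by
  rw [potential, lintegral_smul_measure]; rfl

theorem wcap_ne_top (h : memBreve κ A μ) : wcap κ A ≠ ⊤ :=
  ((iInf₂_le _ h).trans_lt h.1.2).ne

theorem exists_memBreve (h : wcap κ A ≠ ⊤) : ∃ μ, memBreve κ A μ := by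
  by_contra! hn
  exact h (by simp [wcap, hn])

/-- The equilibrium measure of a set `K`: a measure of finite energy on `K` whose potential is at
most `1`, and equal to `1` almost everywhere for every measure of finite energy on `K`. -/
structure IsEquilibrium (κ : X → X → ℝ≥0∞) (K : Set X) (γ : Measure X) : Prop where
  finEnOn : FinEnOn κ K γ
  le_one : ∀ x, potential κ γ x ≤ 1
  ae_eq_one : ∀ ν, FinEnOn κ K ν → ∀ᵐ x ∂ν, potential κ γ x = 1

variable [BorelSpace X] [T2Space X]

theorem IsEquilibrium.mutualEnergy_le (hγ : IsEquilibrium κ K γ) (hκ : IsKernel κ)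
    (hν : FinEn κ ν) : mutualEnergy κ γ ν ≤ ν univ := by
  rw [hγ.finEnOn.1.mutualEnergy_eq hκ hν, ← lintegral_one]
  exact lintegral_mono hγ.le_one

theorem IsEquilibrium.mutualEnergy_eq (hγ : IsEquilibrium κ K γ) (hκ : IsKernel κ)
    (hν : FinEnOn κ K ν) : mutualEnergy κ γ ν = ν univ := by
  rw [hγ.finEnOn.1.mutualEnergy_eq hκ hν.1, ← lintegral_one]
  exact lintegral_congr_ae (hγ.ae_eq_one ν hν)

theorem measure_univ_eq_of_vagueTendsto [LocallyCompactSpace X] {m : ℕ → Measure X}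
    (hK : IsCompact K) (hm : ∀ n, FinEnOn κ K (m n)) (hm1 : ∀ n, m n univ = 1)
    (hμ : FinEnOn κ K μ) (h : VagueTendstoSeq m μ) : μ univ = 1 := by
  obtain ⟨φ, h1, -, hc, -⟩ := exists_continuous_one_zero_of_isCompact hK isClosed_empty
    (disjoint_empty K)
  have key : ∀ ν, FinEnOn κ K ν → ∫ x, φ x ∂ν = ν.real univ := fun ν hν => by
    rw [integral_congr_ae (g := fun _ => (1 : ℝ))
      (measure_mono_null (fun x hx hxK => hx (h1 hxK)) hν.2)]
    simp
  have h2 := h φ φ.continuous hc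
  simp only [key _ (hm _), key _ hμ, measureReal_def, hm1] at h2
  have h3 := tendsto_nhds_unique h2 tendsto_const_nhds
  have := hμ.1.isFinite
  rw [← ENNReal.toReal_eq_toReal_iff' (measure_ne_top _ _) ENNReal.one_ne_top]
  exact h3

/-- Gauss's theorem: the unit measure of minimal energy on a compact set. -/
theorem exists_energy_minimizer [LocallyCompactSpace X] (hκ : IsKernel κ) (hp : IsPerfect κ)
    (hK : IsCompact K) (h : ∃ ν, memBreve κ K ν) :
    ∃ μ, memBreve κ K μ ∧ ∀ ν, memBreve κ K ν → inn κ μ μ ≤ inn κ μ ν := by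
  have hE := hp.1
  obtain ⟨ν₀, hν₀⟩ := h
  have h0 : ∀ ν : Measure X, inn κ 0 ν = 0 := fun ν => by simp [inn, mutualEnergy]
  obtain ⟨μ, hμ, hmin⟩ := exists_minimizer hκ hp hK FinEn.zero
    (C := {ν | FinEnOn κ K ν ∧ ν univ = 1}) ⟨ν₀, (memBreve_iff hν₀.2.2).1 hν₀, hν₀.2.2⟩
    (fun μ hμ => hμ.1)
    (fun μ hμ ν hν a b hab => ⟨(hμ.1.smul hκ a).add hκ hE (hν.1.smul hκ b), by
      rw [Measure.add_apply, Measure.smul_apply, Measure.smul_apply, hμ.2, hν.2, ← add_smul, hab,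
        one_smul]⟩)
    (fun m μ hm hμ hv => ⟨hμ, measure_univ_eq_of_vagueTendsto hK (fun n => (hm n).1)
      (fun n => (hm n).2) hμ hv⟩)
  refine ⟨μ, (memBreve_iff hμ.2).2 hμ.1, fun ν hν => ?_⟩
  simpa [h0] using hmin ν ⟨(memBreve_iff hν.2.2).1 hν, hν.2.2⟩

theorem exists_isEquilibrium [LocallyCompactSpace X] (hκ : IsKernel κ) (hp : IsPerfect κ)
    (hfr : FrostmanMax κ) (hK : IsCompact K) (h : ∃ ν, memBreve κ K ν) :
    ∃ γ, IsEquilibrium κ K γ ∧ γ univ = innerCap κ K ∧ wcap κ K ≠ 0 := by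
  have hE := hp.1
  obtain ⟨μ, hμ, hmin⟩ := exists_energy_minimizer hκ hp hK h
  have hμF := (memBreve_iff hμ.2.2).1 hμ
  have hfin := hμF.1.isFinite
  have hW0 : energy κ μ ≠ 0 := fun h0 => by
    have : μ = 0 := (hE μ 0 hμ.1 FinEn.zero.memEplus).2 (by
      rw [h0]; simp [energy, mutualEnergy])
    simpa [this] using hμ.2.2
  have hWt : energy κ μ ≠ ⊤ := hμ.1.2.ne
  have hw : wcap κ K = energy κ μ := by
    refine le_antisymm (iInf₂_le _ hμ) (le_iInf₂ fun ν hν => ?_)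
    have hνF := (memBreve_iff hν.2.2).1 hν
    rw [← ENNReal.toReal_le_toReal hWt hν.1.2.ne]
    have h1 := hmin ν hν
    have h2 := hμF.1.sq_dist_nonneg hE hνF.1
    change inn κ μ μ ≤ inn κ ν ν
    linarith
  have hge : ∀ ν, FinEnOn κ K ν → ∫⁻ _, energy κ μ ∂ν ≤ ∫⁻ x, potential κ μ x ∂ν := by
    intro ν hν
    have := hν.1.isFinite
    rw [lintegral_const, ← hμF.1.mutualEnergy_eq hκ hν.1]
    by_cases h0 : ν univ = 0
    · simp [h0]
    have h1 := hmin _ (hν.memBreve_smul hκ h0)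
    have hpos : 0 < (ν univ).toReal := ENNReal.toReal_pos h0 (measure_ne_top _ _)
    rw [hμF.1.inn_smul_right hκ hν.1, NNReal.coe_inv, ENNReal.coe_toNNReal_eq_toReal,
      le_inv_mul_iff₀ hpos] at h1
    rw [← ENNReal.toReal_le_toReal (ENNReal.mul_ne_top hWt (measure_ne_top _ _))
      (hμF.1.mutualEnergy_lt_top hE hν.1).ne, ENNReal.toReal_mul, mul_comm]
    exact h1
  have hae : ∀ ν, FinEnOn κ K ν → ∀ᵐ x ∂ν, energy κ μ ≤ potential κ μ x := fun ν hν =>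
    ae_le_of_forall_lintegral_le measurable_const hge hν
  have hlsc := hμF.1.lowerSemicontinuous_potential hκ
  have heq : (fun _ => energy κ μ) =ᵐ[μ] potential κ μ := by
    refine ae_eq_of_ae_le_of_lintegral_le (hae μ hμF) (by simp [hμ.2.2, hWt])
      hlsc.measurable.aemeasurable ?_
    rw [← hμF.1.mutualEnergy_eq hκ hμF.1, lintegral_const, hμ.2.2, mul_one]; rfl
  obtain ⟨c, hc⟩ : ∃ c : ℝ≥0, (c : ℝ≥0∞) = (energy κ μ)⁻¹ :=
    ⟨(energy κ μ)⁻¹.toNNReal, ENNReal.coe_toNNReal (ENNReal.inv_ne_top.2 hW0)⟩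
  have hle : ∀ x, potential κ (c • μ) x ≤ 1 := by
    refine hfr _ (hμF.1.smul hκ c).memEplus fun x hx => ?_
    rw [potential_smul, hc]
    suffices potential κ μ x ≤ energy κ μ by
      rw [← ENNReal.inv_mul_cancel hW0 hWt]; gcongr
    by_contra! hlt
    have h1 := hx _ (hlsc.isOpen_preimage (energy κ μ)) hlt
    have h2 : μ (potential κ μ ⁻¹' Ioi (energy κ μ)) = 0 :=
      measure_mono_null (fun y hy => ne_of_lt hy) (ae_iff.1 heq)
    simp [h2] at h1
  refine ⟨c • μ, ⟨hμF.smul hκ c, hle, fun ν hν => ?_⟩, ?_, hw ▸ hW0⟩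
  · filter_upwards [hae ν hν] with x hx
    refine le_antisymm (hle x) ?_
    rw [potential_smul, hc, ← ENNReal.inv_mul_cancel hW0 hWt]
    gcongr
  · rw [Measure.smul_apply, hμ.2.2, ENNReal.smul_def, hc, innerCap, hw]; simp

/-- Balayage of a measure of finite energy onto a compact set. -/
theorem exists_balayage [LocallyCompactSpace X] (hκ : IsKernel κ) (hp : IsPerfect κ)
    (hdom : DominationPrinciple κ) (hK : IsCompact K) (hζ : FinEn κ ζ) :
    ∃ b, FinEnOn κ K b ∧ ∀ ν, FinEnOn κ K ν → inn κ b ν = inn κ ζ ν := by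
  have hE := hp.1
  have hz : FinEnOn κ K 0 := ⟨FinEn.zero, by simp⟩
  obtain ⟨b, hb, hmin⟩ := exists_minimizer hκ hp hK hζ (C := {ν | FinEnOn κ K ν}) ⟨0, hz⟩
    (fun μ hμ => hμ) (fun μ hμ ν hν a b _ => (hμ.smul hκ a).add hκ hE (hν.smul hκ b))
    (fun m μ _ hμ _ => hμ)
  have hb : FinEnOn κ K b := hb
  have h0 : ∀ ν : Measure X, inn κ ν 0 = 0 := fun ν => by simp [inn, mutualEnergy]
  have h1 : inn κ b b ≤ inn κ ζ b := by simpa [h0] using hmin 0 hz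
  have h2 : ∀ ν, FinEnOn κ K ν → inn κ ζ ν ≤ inn κ b ν := fun ν hν => by
    have := hmin (b + ν) (hb.add hκ hE hν)
    rw [hb.1.inn_add_right hκ hE hb.1 hν.1, hζ.inn_add_right hκ hE hb.1 hν.1] at this
    linarith
  have h3 : ∀ ν, FinEnOn κ K ν → ∫⁻ x, potential κ ζ x ∂ν ≤ ∫⁻ x, potential κ b x ∂ν := by
    intro ν hν
    rw [← hζ.mutualEnergy_eq hκ hν.1, ← hb.1.mutualEnergy_eq hκ hν.1,
      ← ENNReal.toReal_le_toReal (hζ.mutualEnergy_lt_top hE hν.1).ne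
        (hb.1.mutualEnergy_lt_top hE hν.1).ne]
    exact h2 ν hν
  have h4 : potential κ ζ =ᵐ[b] potential κ b := by
    refine ae_eq_of_ae_le_of_lintegral_le (ae_le_of_forall_lintegral_le
      (hζ.lowerSemicontinuous_potential hκ).measurable h3 hb) ?_
      (hb.1.lowerSemicontinuous_potential hκ).measurable.aemeasurable ?_
    · rw [← hζ.mutualEnergy_eq hκ hb.1]
      exact (hζ.mutualEnergy_lt_top hE hb.1).ne
    · rw [← hζ.mutualEnergy_eq hκ hb.1, ← hb.1.mutualEnergy_eq hκ hb.1,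
        ← ENNReal.toReal_le_toReal (hb.1.mutualEnergy_lt_top hE hb.1).ne
          (hζ.mutualEnergy_lt_top hE hb.1).ne]
      exact h1
  have h5 := hdom b ζ hb.1.memEplus hζ.memEplus (h4.mono fun x hx => hx.ge)
  refine ⟨b, hb, fun ν hν => le_antisymm ?_ (h2 ν hν)⟩
  refine ENNReal.toReal_mono (hζ.mutualEnergy_lt_top hE hν.1).ne ?_
  rw [hζ.mutualEnergy_eq hκ hν.1, hb.1.mutualEnergy_eq hκ hν.1]
  exact lintegral_mono h5

end Equilibrium

section Solution

set_option linter.unusedSectionVars false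

open scoped NNReal

variable {κ : X → X → ℝ≥0∞} {μ ν σ ζ β γ l : Measure X} {A K : Set X} {f : X → EReal}

theorem memBreve.mono {B : Set X} (h : memBreve κ A μ) (hAB : A ⊆ B) : memBreve κ B μ :=
  ⟨h.1, fun K hK => measure_mono_null (by gcongr) (h.2.1 K hK), h.2.2⟩

theorem wcap_anti {B : Set X} (hAB : A ⊆ B) : wcap κ B ≤ wcap κ A :=
  le_iInf₂ fun _ hμ => iInf₂_le _ (hμ.mono hAB)

variable [BorelSpace X] [T2Space X]

theorem memBreve.finEnOn (h : memBreve κ A μ) : FinEnOn κ A μ := (memBreve_iff h.2.2).1 h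

theorem FinEn.integrable_potential (hκ : IsKernel κ) (hE : EnergyPrinciple κ) (hμ : FinEn κ μ)
    (hν : FinEn κ ν) : Integrable (fun x => (potential κ μ x).toReal) ν :=
  integrable_toReal_of_lintegral_ne_top
    (hμ.lowerSemicontinuous_potential hκ).measurable.aemeasurable
    (by rw [← hμ.mutualEnergy_eq hκ hν]; exact (hμ.mutualEnergy_lt_top hE hν).ne)

theorem FinEn.integral_potential (hκ : IsKernel κ) (hE : EnergyPrinciple κ) (hμ : FinEn κ μ)
    (hν : FinEn κ ν) : ∫ x, (potential κ μ x).toReal ∂ν = inn κ μ ν := by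
  rw [integral_toReal (hμ.lowerSemicontinuous_potential hκ).measurable.aemeasurable
    (hμ.ae_potential_lt_top hκ hE hν), ← hμ.mutualEnergy_eq hκ hν]; rfl

theorem FinEn.fieldIntegrable (hκ : IsKernel κ) (hE : EnergyPrinciple κ) (hζ : FinEn κ ζ)
    (hf : ∀ x, f x = -((potential κ ζ x : ℝ≥0∞) : EReal)) (hμ : FinEn κ μ) :
    FieldIntegrable f μ := by
  refine ⟨?_, ?_⟩
  · simpa [hf] using (hζ.integrable_potential hκ hE hμ).neg
  · filter_upwards [hζ.ae_potential_lt_top hκ hE hμ] with x hx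
    simp [hf, hx.ne]

theorem FinEn.gaussI_eq (hκ : IsKernel κ) (hE : EnergyPrinciple κ) (hζ : FinEn κ ζ)
    (hf : ∀ x, f x = -((potential κ ζ x : ℝ≥0∞) : EReal)) (hμ : FinEn κ μ) :
    gaussI κ f μ = inn κ μ μ - 2 * inn κ ζ μ := by
  have : fieldIntegral f μ = -inn κ ζ μ := by
    rw [← hζ.integral_potential hκ hE hμ, ← integral_neg, fieldIntegral]
    simp [hf]
  rw [gaussI, this]
  change inn κ μ μ + 2 * -inn κ ζ μ = _
  ring

theorem FinEn.wConst_eq (hκ : IsKernel κ) (hE : EnergyPrinciple κ) (hζ : FinEn κ ζ)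
    (hf : ∀ x, f x = -((potential κ ζ x : ℝ≥0∞) : EReal)) (hμ : FinEn κ μ) :
    wConst κ f μ = inn κ μ μ - inn κ ζ μ := by
  rw [← hζ.integral_potential hκ hE hμ, ← hμ.integral_potential hκ hE hμ,
    ← integral_sub (hμ.integrable_potential hκ hE hμ) (hζ.integrable_potential hκ hE hμ), wConst]
  refine integral_congr_ae ?_
  filter_upwards [hζ.ae_potential_lt_top hκ hE hμ, hμ.ae_potential_lt_top hκ hE hμ] with x hx hx'
  rw [wPotential, hf, ← sub_eq_add_neg, EReal.toReal_sub (by simp [hx'.ne]) (by simp)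
    (by simp [hx.ne]) (by simp), EReal.toReal_coe_ennreal, EReal.toReal_coe_ennreal]

theorem isSolution_iff (hκ : IsKernel κ) (hE : EnergyPrinciple κ) (hζ : FinEn κ ζ)
    (hf : ∀ x, f x = -((potential κ ζ x : ℝ≥0∞) : EReal)) :
    IsSolution κ A f l ↔ memBreve κ A l ∧ ∀ ν, memBreve κ A ν →
      inn κ l l - 2 * inn κ ζ l ≤ inn κ ν ν - 2 * inn κ ζ ν := by
  have adm : ∀ {ν}, memBreve κ A ν → Admissible κ A f ν := fun hν =>
    ⟨hν, hζ.fieldIntegrable hκ hE hf hν.finEnOn.1⟩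
  constructor
  · rintro ⟨hl, hmin⟩
    refine ⟨hl.1, fun ν hν => ?_⟩
    rw [← hζ.gaussI_eq hκ hE hf hl.1.finEnOn.1, ← hζ.gaussI_eq hκ hE hf hν.finEnOn.1,
      ← EReal.coe_le_coe_iff, hmin]
    exact iInf₂_le _ (adm hν)
  · rintro ⟨hl, hmin⟩
    refine ⟨adm hl, le_antisymm (le_iInf₂ fun ν hν => ?_) (iInf₂_le _ (adm hl))⟩
    rw [EReal.coe_le_coe_iff, hζ.gaussI_eq hκ hE hf hl.finEnOn.1,
      hζ.gaussI_eq hκ hE hf hν.1.finEnOn.1]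
    exact hmin ν hν.1

/-- The minimality of a solution, with the quadratic remainder. -/
theorem IsSolution.add_sq_dist_le (hκ : IsKernel κ) (hE : EnergyPrinciple κ) (hζ : FinEn κ ζ)
    (hf : ∀ x, f x = -((potential κ ζ x : ℝ≥0∞) : EReal)) (hl : IsSolution κ A f l)
    (hν : memBreve κ A ν) :
    inn κ l l - 2 * inn κ ζ l + (inn κ ν ν + inn κ l l - 2 * inn κ ν l) ≤
      inn κ ν ν - 2 * inn κ ζ ν := by
  obtain ⟨hlA, hmin⟩ := (isSolution_iff hκ hE hζ hf).1 hl
  have hlF := hlA.finEnOn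
  have hνF := hν.finEnOn
  have h := hζ.first_variation hκ hE hlF.1 hνF.1 fun a b hab => hmin _ <|
    (memBreve_iff (by rw [Measure.add_apply, Measure.smul_apply, Measure.smul_apply, hlA.2.2,
      hν.2.2, ← add_smul, hab, one_smul])).2 ((hlF.smul hκ a).add hκ hE (hνF.smul hκ b))
  rw [inn_comm hκ hνF.1 hlF.1]
  linarith

/-- On a compact set the solution of the Gauss problem for `f = -U^ζ` exists, is unique, and is
the sum of the balayage of `ζ` and a multiple of the equilibrium measure. -/
theorem IsEquilibrium.exists_isSolution [LocallyCompactSpace X] (hκ : IsKernel κ)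
    (hp : IsPerfect κ) (hdom : DominationPrinciple κ) (hK : IsCompact K) (hζ : FinEn κ ζ)
    (hζ1 : ζ univ ≤ 1) (hf : ∀ x, f x = -((potential κ ζ x : ℝ≥0∞) : EReal))
    (hγ : IsEquilibrium κ K γ) (hγ1 : γ univ = innerCap κ K) (hw0 : wcap κ K ≠ 0)
    (hwt : wcap κ K ≠ ⊤) :
    ∃ l, IsSolution κ K f l ∧ (∀ l', IsSolution κ K f l' → l' = l) ∧
      wConst κ f l = (1 - inn κ γ ζ) * (wcap κ K).toReal := by
  have hE := hp.1
  obtain ⟨b, hb, hbζ⟩ := exists_balayage hκ hp hdom hK hζ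
  have hγF := hγ.finEnOn
  have hmass : ∀ ν, FinEnOn κ K ν → inn κ γ ν = (ν univ).toReal := fun ν hν => by
    rw [inn, hγ.mutualEnergy_eq hκ hν]
  have hb1 : (b univ).toReal = inn κ γ ζ := by
    rw [← hmass b hb, inn_comm hκ hγF.1 hb.1, hbζ γ hγF, inn_comm hκ hζ hγF.1]
  have hle : inn κ γ ζ ≤ 1 :=
    ENNReal.toReal_mono ENNReal.one_ne_top ((hγ.mutualEnergy_le hκ hζ).trans hζ1)
  have hwpos : 0 < (wcap κ K).toReal := ENNReal.toReal_pos hw0 hwt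
  obtain ⟨c, hc⟩ : ∃ c : ℝ≥0, (c : ℝ) = (1 - inn κ γ ζ) * (wcap κ K).toReal :=
    ⟨⟨_, mul_nonneg (by linarith) hwpos.le⟩, rfl⟩
  have hlF : FinEnOn κ K (b + c • γ) := hb.add hκ hE (hγF.smul hκ c)
  have hl1 : (b + c • γ) univ = 1 := by
    have := hlF.1.isFinite
    have := hb.1.isFinite
    have := hγF.1.isFinite
    rw [← ENNReal.toReal_eq_toReal_iff' (measure_ne_top _ _) ENNReal.one_ne_top,
      Measure.add_apply, ENNReal.toReal_add (measure_ne_top _ _) (measure_ne_top _ _), hb1,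
      Measure.smul_apply, ENNReal.smul_def, smul_eq_mul, ENNReal.toReal_mul, hγ1, innerCap,
      ENNReal.toReal_inv, ENNReal.coe_toReal, hc, mul_assoc, mul_inv_cancel₀ hwpos.ne']
    simp
  have hlB : memBreve κ K (b + c • γ) := (memBreve_iff hl1).2 hlF
  have hinn : ∀ ν, memBreve κ K ν → inn κ (b + c • γ) ν = inn κ ζ ν + c := fun ν hν => by
    rw [hb.1.inn_add_left hE (hγF.smul hκ c).1 hν.finEnOn.1, hbζ ν hν.finEnOn,
      hν.finEnOn.1.inn_smul_left, hmass ν hν.finEnOn, hν.2.2]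
    simp
  have hll := hinn _ hlB
  refine ⟨b + c • γ, (isSolution_iff hκ hE hζ hf).2 ⟨hlB, fun ν hν => ?_⟩, fun l' hl' => ?_, ?_⟩
  · have := hlF.1.sq_dist_nonneg hE hν.finEnOn.1
    rw [hinn ν hν] at this
    linarith
  · obtain ⟨hl'B, hmin⟩ := (isSolution_iff hκ hE hζ hf).1 hl'
    refine (hlF.1.eq_of_sq_dist_nonpos hE hl'B.finEnOn.1 ?_).symm
    have := hmin _ hlB
    rw [hinn l' hl'B]
    linarith
  · rw [hζ.wConst_eq hκ hE hf hlF.1, hll, ← hc]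
    ring

theorem IsEquilibrium.inn_le_of_subset (hκ : IsKernel κ) (hE : EnergyPrinciple κ)
    (hdom : DominationPrinciple κ) {L : Set X} {δ : Measure X} (hγ : IsEquilibrium κ K γ)
    (hδ : IsEquilibrium κ L δ) (hKL : K ⊆ L) (hζ : FinEn κ ζ) : inn κ γ ζ ≤ inn κ δ ζ := by
  have h := hdom γ δ hγ.finEnOn.1.memEplus hδ.finEnOn.1.memEplus
    ((hδ.ae_eq_one γ (hγ.finEnOn.mono hKL)).mono fun x hx => hx ▸ hγ.le_one x)
  refine ENNReal.toReal_mono (hδ.finEnOn.1.mutualEnergy_lt_top hE hζ).ne ?_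
  rw [hγ.finEnOn.1.mutualEnergy_eq hκ hζ, hδ.finEnOn.1.mutualEnergy_eq hκ hζ]
  exact lintegral_mono h

theorem memEplus.finEnOn_restrict (hE : EnergyPrinciple κ) (hμ : memEplus κ μ)
    (hμA : Concentrated μ A) (hK : IsCompact K) : FinEnOn κ A (μ.restrict K) :=
  ⟨FinEn.restrict_of_memEplus hE hμ hK, by
    rw [Measure.restrict_apply' hK.measurableSet]; exact hμA K hK⟩

theorem IsInnerBalayage.potential_restrict_le (hκ : IsKernel κ) (hE : EnergyPrinciple κ)
    (hdom : DominationPrinciple κ) (hβ : IsInnerBalayage κ A ζ β) (hζ : FinEn κ ζ)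
    (hK : IsCompact K) (x : X) : potential κ (β.restrict K) x ≤ potential κ ζ x := by
  have hβK := hβ.1.finEnOn_restrict hE hβ.2.1 hK
  refine hdom _ _ hβK.1.memEplus hζ.memEplus ?_ x
  refine measure_eq_zero_of_innerCap_eq_zero hκ hβK
    (measurableSet_le (hβK.1.lowerSemicontinuous_potential hκ).measurable
      (hζ.lowerSemicontinuous_potential hκ).measurable).compl (fun x hx => ?_) hβ.2.2
  refine ⟨hx.1, fun heq => hx.2 ?_⟩
  change potential κ (β.restrict K) x ≤ potential κ ζ x
  rw [← heq]
  exact lintegral_mono' Measure.restrict_le_self le_rfl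

theorem IsInnerBalayage.measure_univ_le [LocallyCompactSpace X] (hκ : IsKernel κ)
    (hp : IsPerfect κ) (hfr : FrostmanMax κ) (hdom : DominationPrinciple κ)
    (hβ : IsInnerBalayage κ A ζ β) (hζ : FinEn κ ζ) : β univ ≤ ζ univ := by
  have hE := hp.1
  have := hβ.1.1
  unfold IsRadon at this
  rw [isOpen_univ.measure_eq_iSup_isCompact β]
  refine iSup₂_le fun K _ => iSup_le fun hK => ?_
  have hβK : FinEnOn κ K (β.restrict K) :=
    ⟨(hβ.1.finEnOn_restrict hE hβ.2.1 hK).1, by simp [hK.measurableSet]⟩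
  by_cases h0 : (β.restrict K) univ = 0
  · simp_all
  obtain ⟨γ, hγ, -, -⟩ := exists_isEquilibrium hκ hp hfr hK ⟨_, hβK.memBreve_smul hκ h0⟩
  have := hζ.isFinite
  have := hγ.finEnOn.1.isFinite
  calc β K = (β.restrict K) univ := by simp
    _ = mutualEnergy κ γ (β.restrict K) := (hγ.mutualEnergy_eq hκ hβK).symm
    _ = ∫⁻ x, potential κ (β.restrict K) x ∂γ := by
      have := hβK.1.isFinite
      rw [mutualEnergy_comm hκ, hβK.1.mutualEnergy_eq hκ hγ.finEnOn.1]
    _ ≤ ∫⁻ x, potential κ ζ x ∂γ := lintegral_mono (hβ.potential_restrict_le hκ hE hdom hζ hK)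
    _ = mutualEnergy κ γ ζ := by
      rw [mutualEnergy_comm hκ, hζ.mutualEnergy_eq hκ hγ.finEnOn.1]
    _ ≤ ζ univ := hγ.mutualEnergy_le hκ hζ

theorem IsInnerBalayage.finEnOn (hβ : IsInnerBalayage κ A ζ β) (hβt : β univ < ⊤) :
    FinEnOn κ A β := by
  have h : FinEn κ β := ⟨⟨hβt⟩, hβ.1.1, hβ.1.2⟩
  exact ⟨h, h.concentrated_iff.1 hβ.2.1⟩

theorem IsInnerBalayage.inn_eq (hκ : IsKernel κ) (hβ : IsInnerBalayage κ A ζ β)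
    (hβt : β univ < ⊤) (hζ : FinEn κ ζ) (hν : FinEnOn κ A ν) : inn κ β ν = inn κ ζ ν := by
  have hβF := hβ.finEnOn hβt
  rw [inn, inn, hβF.1.mutualEnergy_eq hκ hν.1, hζ.mutualEnergy_eq hκ hν.1]
  congr 1
  refine lintegral_congr_ae (measure_eq_zero_of_innerCap_eq_zero hκ hν
    (measurableSet_eq_fun (hβF.1.lowerSemicontinuous_potential hκ).measurable
      (hζ.lowerSemicontinuous_potential hκ).measurable).compl (fun x hx => hx) hβ.2.2)

end Solution

section Limits

set_option linter.unusedSectionVars false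

open scoped NNReal

variable {κ : X → X → ℝ≥0∞} {μ ν σ ζ β γ l : Measure X} {A K : Set X} {f : X → EReal}

/-- The compact subsets of `A`, ordered by inclusion. -/
abbrev CompactsIn (A : Set X) : Type _ := {K : Set X // IsCompact K ∧ K ⊆ A}

instance : Nonempty (CompactsIn A) := ⟨⟨∅, isCompact_empty, empty_subset A⟩⟩

instance : IsDirectedOrder (CompactsIn A) :=
  ⟨fun K L => ⟨⟨K.1 ∪ L.1, K.2.1.union L.2.1, union_subset K.2.2 L.2.2⟩,
    subset_union_left, subset_union_right⟩⟩

variable [BorelSpace X] [T2Space X]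

theorem FinEnOn.exists_lt_measure_compact (hμ : FinEnOn κ A μ) {r : ℝ≥0∞} (hr : r < μ univ) :
    ∃ K, IsCompact K ∧ K ⊆ A ∧ r < μ K := by
  have := hμ.1.isFinite
  have := hμ.1.regular
  have hm := measurableSet_toMeasurable μ Aᶜ
  have h1 : μ (toMeasurable μ Aᶜ)ᶜ = μ univ :=
    measure_of_measure_compl_eq_zero (by rw [compl_compl, measure_toMeasurable]; exact hμ.2)
  obtain ⟨K, hKs, hK, hlt⟩ := hm.compl.exists_lt_isCompact_of_ne_top
    (measure_ne_top _ _) (h1 ▸ hr)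
  exact ⟨K, hK, hKs.trans (compl_subset_comm.1 (subset_toMeasurable μ Aᶜ)), hlt⟩

theorem FinEnOn.tendsto_measure_compact (hμ : FinEnOn κ A μ) :
    Tendsto (fun K : CompactsIn A => μ K.1) atTop (𝓝 (μ univ)) := by
  refine tendsto_order.2 ⟨fun r hr => ?_, fun r hr =>
    Eventually.of_forall fun K => (measure_mono (subset_univ _)).trans_lt hr⟩
  obtain ⟨K, hK, hKA, hlt⟩ := hμ.exists_lt_measure_compact hr
  filter_upwards [eventually_ge_atTop ⟨K, hK, hKA⟩] with L hL
  exact hlt.trans_le (measure_mono hL)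

theorem FinEnOn.tendsto_inn_restrict (hκ : IsKernel κ) (hE : EnergyPrinciple κ)
    (hμ : FinEnOn κ A μ) (hζ : FinEn κ ζ) :
    Tendsto (fun K : CompactsIn A => inn κ ζ (μ.restrict K.1)) atTop (𝓝 (inn κ ζ μ)) := by
  have := hμ.1.isFinite
  have h1 : Tendsto (fun K : CompactsIn A => μ K.1ᶜ) atTop (𝓝 0) := by
    have h := ENNReal.Tendsto.sub (tendsto_const_nhds (x := μ univ)) hμ.tendsto_measure_compact
      (Or.inl (measure_ne_top _ _))
    rw [tsub_self] at h
    exact h.congr fun K => (measure_compl K.2.1.measurableSet (measure_ne_top _ _)).symm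
  have h2 := tendsto_setLIntegral_zero (f := potential κ ζ) (μ := μ)
    (by rw [← hζ.mutualEnergy_eq hκ hμ.1]; exact (hζ.mutualEnergy_lt_top hE hμ.1).ne) h1
  have h3 := (ENNReal.tendsto_toReal ENNReal.zero_ne_top).comp h2
  have h4 := h3.const_sub (inn κ ζ μ)
  simp only [ENNReal.toReal_zero, sub_zero] at h4
  refine h4.congr fun K => ?_
  have h5 := hζ.inn_add_right hκ hE (hμ.1.restrict K.1) (hμ.1.restrict K.1ᶜ)
  rw [Measure.restrict_add_restrict_compl K.2.1.measurableSet] at h5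
  simp only [Function.comp_apply]
  rw [← hζ.mutualEnergy_eq hκ (hμ.1.restrict K.1ᶜ), h5]
  simp [inn]

/-- A unit measure of finite energy on `A` is approximated by unit measures on compact sets. -/
theorem memBreve.exists_approx (hκ : IsKernel κ) (hE : EnergyPrinciple κ) (hμ : memBreve κ A μ) :
    ∃ (m : CompactsIn A → Measure X) (t : CompactsIn A → ℝ≥0),
      (∀ᶠ K in atTop, memBreve κ K.1 (m K)) ∧ Tendsto (fun K => (t K : ℝ)) atTop (𝓝 1) ∧
      (∀ K, inn κ (m K) (m K) ≤ t K * t K * inn κ μ μ) ∧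
      ∀ ζ, FinEn κ ζ → Tendsto (fun K => inn κ ζ (m K)) atTop (𝓝 (inn κ ζ μ)) := by
  have hμF := hμ.finEnOn
  have := hμF.1.isFinite
  have hlim := hμF.tendsto_measure_compact
  rw [hμ.2.2] at hlim
  have ht : Tendsto (fun K : CompactsIn A => (((μ K.1).toNNReal⁻¹ : ℝ≥0) : ℝ)) atTop (𝓝 1) := by
    have h := ((ENNReal.tendsto_toReal ENNReal.one_ne_top).comp hlim).inv₀ (by simp)
    rw [ENNReal.toReal_one, inv_one] at h
    exact h.congr fun K => by rw [NNReal.coe_inv]; rfl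
  refine ⟨fun K => (μ K.1).toNNReal⁻¹ • μ.restrict K.1, fun K => (μ K.1).toNNReal⁻¹, ?_, ht,
    fun K => ?_, fun ζ hζ => ?_⟩
  · filter_upwards [hlim.eventually_ne one_ne_zero] with K hK
    have h : FinEnOn κ K.1 (μ.restrict K.1) :=
      ⟨hμF.1.restrict _, by simp [K.2.1.measurableSet]⟩
    simpa using h.memBreve_smul hκ (by simpa using hK)
  · have hr := hμF.1.restrict K.1
    rw [(hr.smul hκ _).inn_smul_left, hr.inn_smul_right hκ hr, mul_assoc]
    gcongr
    exact ENNReal.toReal_mono hμF.1.energy_lt_top.ne (mutualEnergy_restrict_le _ _)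
  · have h := ht.mul (hμF.tendsto_inn_restrict hκ hE hζ)
    rw [one_mul] at h
    exact h.congr fun K => (hζ.inn_smul_right hκ (hμF.1.restrict K.1) _).symm

theorem exists_compact_memBreve (hκ : IsKernel κ) (hE : EnergyPrinciple κ) (h : wcap κ A ≠ ⊤) :
    ∃ K : CompactsIn A, ∃ μ, memBreve κ K.1 μ := by
  obtain ⟨μ, hμ⟩ := exists_memBreve h
  obtain ⟨m, -, hm, -⟩ := hμ.exists_approx hκ hE
  obtain ⟨K, hK⟩ := hm.exists
  exact ⟨K, m K, hK⟩

theorem tendsto_wcap (hκ : IsKernel κ) (hE : EnergyPrinciple κ) (h : wcap κ A ≠ ⊤) :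
    Tendsto (fun K : CompactsIn A => (wcap κ K.1).toReal) atTop (𝓝 (wcap κ A).toReal) := by
  refine tendsto_order.2 ⟨fun r hr => ?_, fun r hr => ?_⟩
  · obtain ⟨K, μ, hμ⟩ := exists_compact_memBreve hκ hE h
    filter_upwards [eventually_ge_atTop K] with L hL
    exact hr.trans_le (ENNReal.toReal_mono (wcap_ne_top (hμ.mono hL)) (wcap_anti L.2.2))
  · obtain ⟨μ, hμ, hlt⟩ : ∃ μ, memBreve κ A μ ∧ energy κ μ < ENNReal.ofReal r := by
      have h1 : wcap κ A < ENNReal.ofReal r := (ENNReal.lt_ofReal_iff_toReal_lt h).2 hr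
      simpa only [wcap, iInf_lt_iff, exists_prop] using h1
    obtain ⟨m, t, hm, ht, hle, -⟩ := hμ.exists_approx hκ hE
    have hlim := (ht.mul ht).mul_const (inn κ μ μ)
    rw [one_mul, one_mul] at hlim
    have hr' : inn κ μ μ < r := (ENNReal.lt_ofReal_iff_toReal_lt hμ.1.2.ne).1 hlt
    filter_upwards [hm, hlim.eventually_lt_const hr'] with K hK hK'
    exact ((ENNReal.toReal_mono hK.1.2.ne (iInf₂_le _ hK)).trans (hle K)).trans_lt hK'

/-- The constants of the solutions on compact sets converge to the constant of the solution. -/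
theorem IsSolution.tendsto_wConst (hκ : IsKernel κ) (hE : EnergyPrinciple κ) (hζ : FinEn κ ζ)
    (hf : ∀ x, f x = -((potential κ ζ x : ℝ≥0∞) : EReal)) (hl : IsSolution κ A f l)
    {lam : CompactsIn A → Measure X} (hlam : ∀ᶠ K in atTop, IsSolution κ K.1 f (lam K)) :
    Tendsto (fun K => wConst κ f (lam K)) atTop (𝓝 (wConst κ f l)) := by
  have hlB := hl.1.1
  have hlF := hlB.finEnOn.1
  obtain ⟨m, t, hm, ht, hle, hmζ⟩ := hlB.exists_approx hκ hE
  have hF : ∀ᶠ K in atTop, FinEn κ (lam K) := hlam.mono fun K hK => hK.1.1.finEnOn.1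
  have hup : Tendsto (fun K => t K * t K * inn κ l l - 2 * inn κ ζ (m K) -
      (inn κ l l - 2 * inn κ ζ l)) atTop (𝓝 0) := by
    have h := ((((ht.mul ht).mul_const (inn κ l l)).sub ((hmζ ζ hζ).const_mul 2)).sub_const
      (inn κ l l - 2 * inn κ ζ l))
    simpa using h
  have hD : Tendsto (fun K => inn κ (lam K) (lam K) + inn κ l l - 2 * inn κ (lam K) l)
      atTop (𝓝 0) := by
    refine tendsto_of_tendsto_of_tendsto_of_le_of_le' tendsto_const_nhds hup ?_ ?_
    · filter_upwards [hF] with K hK using hK.sq_dist_nonneg hE hlF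
    · filter_upwards [hlam, hm] with K hK hmK
      have h1 := hl.add_sq_dist_le hκ hE hζ hf (hK.1.1.mono K.2.2)
      have h2 := ((isSolution_iff hκ hE hζ hf).1 hK).2 _ hmK
      have h3 := hle K
      linarith
  rw [hζ.wConst_eq hκ hE hf hlF]
  have hlim := (hlF.tendsto_inn_self hκ hE hF hD).sub (hlF.tendsto_inn_left hκ hE hF hD hζ)
  rw [inn_comm hκ hlF hζ] at hlim
  refine hlim.congr' ?_
  filter_upwards [hF] with K hK
  rw [hζ.wConst_eq hκ hE hf hK, inn_comm hκ hK hζ]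

/-- The swept mass `∫ U^γ dζ` of the compact subsets of `A` converges to the swept mass of `A`. -/
theorem IsInnerBalayage.tendsto_inn (hκ : IsKernel κ)
    (hβ : IsInnerBalayage κ A ζ β) (hβt : β univ < ⊤) (hζ : FinEn κ ζ)
    {g : CompactsIn A → Measure X} (hg : ∀ᶠ K in atTop, IsEquilibrium κ K.1 (g K)) :
    Tendsto (fun K => inn κ (g K) ζ) atTop (𝓝 (β univ).toReal) := by
  have hβF := hβ.finEnOn hβt
  have := hβF.1.isFinite
  refine tendsto_of_tendsto_of_tendsto_of_le_of_le' (h := fun _ => (β univ).toReal)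
    ((ENNReal.tendsto_toReal hβt.ne).comp hβF.tendsto_measure_compact) tendsto_const_nhds ?_ ?_
  all_goals
    filter_upwards [hg] with K hK
    rw [inn_comm hκ hK.finEnOn.1 hζ, ← hβ.inn_eq hκ hβt hζ (hK.finEnOn.mono K.2.2),
      inn_comm hκ hβF.1 hK.finEnOn.1]
  · have h1 : FinEnOn κ K.1 (β.restrict K.1) :=
      ⟨hβF.1.restrict _, by simp [K.2.1.measurableSet]⟩
    refine ENNReal.toReal_mono
      ((hK.mutualEnergy_le hκ hβF.1).trans_lt hβt).ne ?_
    change β K.1 ≤ _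
    rw [← Measure.restrict_apply_univ K.1, ← hK.mutualEnergy_eq hκ h1]
    exact lintegral_mono' (Measure.prod_mono le_rfl Measure.restrict_le_self) le_rfl
  · exact ENNReal.toReal_mono hβt.ne (hK.mutualEnergy_le hκ hβF.1)

/-- On every compact subset of `A` which carries a unit measure of finite energy, the solution
exists, is unique, and its constant is given in terms of an equilibrium measure. -/
theorem exists_equilibrium_solution [LocallyCompactSpace X] (hκ : IsKernel κ) (hp : IsPerfect κ)
    (hfr : FrostmanMax κ) (hdom : DominationPrinciple κ) (hζ : FinEn κ ζ) (hζ1 : ζ univ ≤ 1)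
    (hf : ∀ x, f x = -((potential κ ζ x : ℝ≥0∞) : EReal)) (hK : IsCompact K)
    (hμ : memBreve κ K μ) :
    ∃ γ, IsEquilibrium κ K γ ∧ (∃! l, IsSolution κ K f l) ∧
      ∀ l, IsSolution κ K f l → wConst κ f l = (1 - inn κ γ ζ) * (wcap κ K).toReal := by
  obtain ⟨γ, hγ, hγ1, hw0⟩ := exists_isEquilibrium hκ hp hfr hK ⟨μ, hμ⟩
  obtain ⟨l, hl, huniq, hc⟩ := hγ.exists_isSolution hκ hp hdom hK hζ hζ1 hf hγ1 hw0
    (wcap_ne_top hμ)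
  exact ⟨γ, hγ, ⟨l, hl, huniq⟩, fun l' hl' => huniq l' hl' ▸ hc⟩

end Limits

theorem stmt8 {X : Type*} [TopologicalSpace X] [T2Space X] [LocallyCompactSpace X]
    [MeasurableSpace X] [BorelSpace X]
    (κ : X → X → ℝ≥0∞) (A : Set X) (ζ β : Measure X) (f : X → EReal)
    (hker : IsKernel κ) (hperf : IsPerfect κ)
    (hfr : FrostmanMax κ) (hdom : DominationPrinciple κ)
    (hcap0 : innerCap κ A ≠ 0) (hclosed : StrongClosedEplusOn κ A)
    (hζ : memEplus κ ζ) (hζ1 : ζ Set.univ ≤ 1)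
    (hf : ∀ x, f x = -((potential κ ζ x : ℝ≥0∞) : EReal))
    (hβ : IsInnerBalayage κ A ζ β)
    (hex : innerCap κ A ≠ ⊤ ∨ β Set.univ = 1)
    (l : Measure X) (hl : IsSolution κ A f l) :
    -- `c_{A,f} = η_{A,f}`
    ((wConst κ f l : ℝ) : EReal)
      = ((((1 : ℝ≥0∞) - β Set.univ) / innerCap κ A : ℝ≥0∞) : EReal) ∧
    -- the net `c_{K,f}` is decreasing and converges to `c_{A,f}` as `K ↑ A`
    ∃ K₀ : Set X, IsCompact K₀ ∧ K₀ ⊆ A ∧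
      (∀ K : Set X, IsCompact K → K ⊆ A → K₀ ⊆ K →
        ∃! lK : Measure X, IsSolution κ K f lK) ∧
      ∀ lam : {K : Set X // IsCompact K ∧ K ⊆ A} → Measure X,
        (∀ K : {K : Set X // IsCompact K ∧ K ⊆ A}, K₀ ⊆ K.1 →
          IsSolution κ K.1 f (lam K)) →
        (∀ K₁ K₂ : {K : Set X // IsCompact K ∧ K ⊆ A}, K₀ ⊆ K₁.1 → K₁ ≤ K₂ →
          wConst κ f (lam K₂) ≤ wConst κ f (lam K₁)) ∧
        Tendsto (fun K => wConst κ f (lam K)) atTop (𝓝 (wConst κ f l)) := by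
  have hE := hperf.1
  have hζF : FinEn κ ζ := ⟨⟨hζ1.trans_lt ENNReal.one_lt_top⟩, hζ.1, hζ.2⟩
  have hwA : wcap κ A ≠ ⊤ := by simpa [innerCap] using hcap0
  have hβ1 : β univ ≤ 1 := (hβ.measure_univ_le hker hperf hfr hdom hζF).trans hζ1
  have hβt : β univ < ⊤ := hβ1.trans_lt ENNReal.one_lt_top
  obtain ⟨K₀, μ, hμ⟩ := exists_compact_memBreve hker hE hwA
  have hex₀ : ∀ K : CompactsIn A, K₀ ≤ K → ∃ γ, IsEquilibrium κ K.1 γ ∧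
      (∃! l, IsSolution κ K.1 f l) ∧
      ∀ l, IsSolution κ K.1 f l → wConst κ f l = (1 - inn κ γ ζ) * (wcap κ K.1).toReal :=
    fun K hK => exists_equilibrium_solution hker hperf hfr hdom hζF hζ1 hf K.2.1 (hμ.mono hK)
  choose! g hg hsol hconst using hex₀
  have hev := eventually_ge_atTop K₀
  have hlim : ∀ lam : CompactsIn A → Measure X,
      (∀ K, K₀ ≤ K → IsSolution κ K.1 f (lam K)) →
      Tendsto (fun K => wConst κ f (lam K)) atTop (𝓝 (wConst κ f l)) := fun lam hlam =>
    hl.tendsto_wConst hker hE hζF hf (hev.mono hlam)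
  refine ⟨?_, K₀.1, K₀.2.1, K₀.2.2, fun K hK hKA hK₀ => hsol ⟨K, hK, hKA⟩ hK₀,
    fun lam hlam => ⟨fun K₁ K₂ h₁ h₁₂ => ?_, hlim lam hlam⟩⟩
  · have hsol' : ∀ K : CompactsIn A, K₀ ≤ K → ∃ l, IsSolution κ K.1 f l :=
      fun K hK => (hsol K hK).exists
    choose! lam hlam using hsol'
    have heta : Tendsto (fun K => wConst κ f (lam K)) atTop
        (𝓝 ((1 - (β univ).toReal) * (wcap κ A).toReal)) := by
      refine (((hβ.tendsto_inn hker hβt hζF (hev.mono hg)).const_sub 1).mul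
        (tendsto_wcap hker hE hwA)).congr' ?_
      filter_upwards [hev] with K hK
      rw [hconst K hK _ (hlam K hK)]
    have htop : (1 - β univ) * wcap κ A ≠ ⊤ :=
      ENNReal.mul_ne_top (ENNReal.sub_ne_top ENNReal.one_ne_top) hwA
    rw [tendsto_nhds_unique (hlim lam hlam) heta, innerCap, div_eq_mul_inv, inv_inv,
      ← EReal.coe_ennreal_toReal htop, ENNReal.toReal_mul,
      ENNReal.toReal_sub_of_le hβ1 ENNReal.one_ne_top, ENNReal.toReal_one]
  · have h₂ : K₀ ≤ K₂ := le_trans h₁ h₁₂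
    rw [hconst K₁ h₁ _ (hlam K₁ h₁), hconst K₂ h₂ _ (hlam K₂ h₂)]
    have hle : inn κ (g K₂) ζ ≤ 1 := ENNReal.toReal_mono ENNReal.one_ne_top
      (((hg K₂ h₂).mutualEnergy_le hker hζF).trans hζ1)
    have hmono := (hg K₁ h₁).inn_le_of_subset hker hE hdom (hg K₂ h₂) h₁₂ hζF
    have hw := ENNReal.toReal_mono (wcap_ne_top (hμ.mono h₁)) (wcap_anti (κ := κ) h₁₂)
    exact mul_le_mul (by linarith) hw ENNReal.toReal_nonneg (by linarith)

end GaussVar
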